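/- arXiv:0904.4004 — 3 statements merged into one kernel-verified Lean document; each statement's English description precedes it below -/
import Mathlib

section
/- Let K → P be a flat, essentially of finite type homomorphism of commutative noetherian rings, Pᵉ = P ⊗_K P, and I = ker(μ : Pᵉ → P). If K → P is essentially smooth, then for each prime ideal 𝔪 of Pᵉ containing I, the ideal I_𝔪 is generated by a regular sequence. -/
/-!
STATEMENT 1: If `K → P` is flat, essentially of finite type between commutative
noetherian rings and essentially smooth, and `I = ker(μ : P ⊗[K] P → P)`, then
for each prime `𝔪 ⊇ I` of `Pᵉ = P ⊗[K] P`, the localized ideal `I_𝔪` is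
generated by a regular sequence.
-/

open TensorProduct

/-- Essentially smooth: essentially of finite type, flat, and geometrically regular
fibers (equivalently, formally smooth). -/
def EssentiallySmooth (K P : Type) [CommRing K] [CommRing P] [Algebra K P] : Prop :=
  Algebra.EssFiniteType K P ∧ Module.Flat K P ∧ Algebra.FormallySmooth K P

namespace MvPolynomial

theorem mem_idealOfVars_iff_constantCoeff {σ A : Type*} [CommRing A] (f : MvPolynomial σ A) :
    f ∈ idealOfVars σ A ↔ constantCoeff f = 0 := by
  rw [← pow_one (idealOfVars σ A), mem_pow_idealOfVars_iff']
  simp [Finsupp.degree_eq_zero_iff, constantCoeff_eq]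

theorem mem_span_X_sup_pow_idealOfVars_iff {σ A : Type*} [CommRing A] (s : Set σ) (k : ℕ)
    (f : MvPolynomial σ A) :
    f ∈ Ideal.span (X '' s) ⊔ idealOfVars σ A ^ k ↔
      ∀ d ∈ f.support, (∃ i ∈ s, d i ≠ 0) ∨ k ≤ d.degree := by
  classical
  constructor
  · intro hf d hd
    obtain ⟨g, hg, h, hh, rfl⟩ := Submodule.mem_sup.mp hf
    rcases Finset.mem_union.mp (support_add hd) with hd | hd
    · exact Or.inl (mem_ideal_span_X_image.mp hg d hd)
    · exact Or.inr ((mem_pow_idealOfVars_iff k h).mp hh d hd)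
  · intro hf
    rw [f.as_sum]
    refine Ideal.sum_mem _ fun d hd ↦ ?_
    have hsupp : ∀ m ∈ (monomial d (coeff d f)).support, m = d := fun m hm ↦
      Finset.mem_singleton.mp (support_monomial_subset hm)
    rcases hf d hd with h | h
    · refine Ideal.mem_sup_left (mem_ideal_span_X_image.mpr fun m hm ↦ ?_)
      rwa [hsupp m hm]
    · refine Ideal.mem_sup_right ((mem_pow_idealOfVars_iff k _).mpr fun m hm ↦ ?_)
      rwa [hsupp m hm]

theorem mem_of_X_mul_mem_span_X_sup_pow_idealOfVars {σ A : Type*} [CommRing A] {s : Set σ}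
    {i : σ} (hi : i ∉ s) {k : ℕ} {f : MvPolynomial σ A}
    (hf : X i * f ∈ Ideal.span (X '' s) ⊔ idealOfVars σ A ^ (k + 1)) :
    f ∈ Ideal.span (X '' s) ⊔ idealOfVars σ A ^ k := by
  classical
  rw [mem_span_X_sup_pow_idealOfVars_iff] at hf ⊢
  intro d hd
  have hd' : Finsupp.single i 1 + d ∈ (X i * f).support := by
    rw [mem_support_iff, coeff_X_mul]
    exact mem_support_iff.mp hd
  rcases hf _ hd' with ⟨j, hj, hne⟩ | h
  · refine Or.inl ⟨j, hj, ?_⟩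
    have hij : i ≠ j := fun h ↦ hi (h ▸ hj)
    simpa [Finsupp.single_eq_of_ne hij.symm] using hne
  · right
    simp at h
    omega

end MvPolynomial

/-- An algebra map onto a nilpotent thickening of the base is surjective as soon as its image
generates the nilpotent ideal. -/
theorem AlgHom.surjective_of_isNilpotent_map {A B C : Type*} [CommRing A] [CommRing B]
    [CommRing C] [Algebra A B] [Algebra A C] (f : B →ₐ[A] C) (b : Ideal B)
    (hnil : IsNilpotent (b.map f)) (h : ∀ c, ∃ a, c - algebraMap A C a ∈ b.map f) :
    Function.Surjective f := by
  have key : ∀ j : ℕ, ∀ c ∈ (b.map f) ^ j, ∃ d, c - f d ∈ (b.map f) ^ (j + 1) := by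
    intro j c hc
    rw [← Ideal.map_pow] at hc
    refine Submodule.span_induction ?_ ?_ ?_ ?_ hc
    · rintro _ ⟨d, -, rfl⟩
      exact ⟨d, by simp⟩
    · exact ⟨0, by simp⟩
    · rintro x y - - ⟨d, hd⟩ ⟨e, he⟩
      refine ⟨d + e, ?_⟩
      rw [map_add, add_sub_add_comm]
      exact add_mem hd he
    · rintro r x hx ⟨d, hd⟩
      obtain ⟨a, ha⟩ := h r
      refine ⟨algebraMap A B a * d, ?_⟩
      have hx' : x ∈ (b.map f) ^ j := by rwa [← Ideal.map_pow]
      have h1 : (r - algebraMap A C a) * x ∈ (b.map f) ^ (j + 1) := by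
        rw [pow_succ']
        exact Ideal.mul_mem_mul ha hx'
      have h2 := Ideal.mul_mem_left _ (algebraMap A C a) hd
      have : r • x - f (algebraMap A B a * d) =
          (r - algebraMap A C a) * x + algebraMap A C a * (x - f d) := by
        simp only [map_mul, AlgHom.commutes, smul_eq_mul]
        ring
      rw [this]
      exact add_mem h1 h2
  have key' : ∀ j : ℕ, ∀ c, ∃ d, c - f d ∈ (b.map f) ^ j := by
    intro j
    induction j with
    | zero => exact fun c ↦ ⟨0, by simp⟩
    | succ j ih =>
      intro c
      obtain ⟨d, hd⟩ := ih c
      obtain ⟨e, he⟩ := key j _ hd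
      exact ⟨d + e, by rwa [map_add, ← sub_sub]⟩
  obtain ⟨n, hn⟩ := hnil
  intro c
  obtain ⟨d, hd⟩ := key' n c
  rw [hn] at hd
  exact ⟨d, (sub_eq_zero.mp hd).symm⟩

section Retraction

variable {A R : Type*} [CommRing A] [CommRing R] [Algebra A R] (π : R →ₐ[A] A) {σ : Type*}
  {x : σ → R}

theorem aeval_mem_ker_iff (hx : ∀ i, π (x i) = 0) (f : MvPolynomial σ A) :
    MvPolynomial.aeval x f ∈ RingHom.ker π ↔ f ∈ MvPolynomial.idealOfVars σ A := by
  rw [MvPolynomial.mem_idealOfVars_iff_constantCoeff, RingHom.mem_ker, ← AlgHom.comp_apply,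
    MvPolynomial.comp_aeval]
  simp [hx, MvPolynomial.aeval_def, MvPolynomial.eval₂_zero'_apply]

theorem map_aeval_idealOfVars :
    (MvPolynomial.idealOfVars σ A).map (MvPolynomial.aeval x : _ →ₐ[A] R) =
      Ideal.span (Set.range x) := by
  rw [MvPolynomial.idealOfVars, Ideal.map_span, ← Set.range_comp]
  congr 2
  ext i
  simp

theorem mkₐ_comp_aeval_surjective (hx : Ideal.span (Set.range x) = RingHom.ker π) (k : ℕ) :
    Function.Surjective ((Ideal.Quotient.mkₐ A (RingHom.ker π ^ k)).comp
      (MvPolynomial.aeval x)) := by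
  have hmap : (MvPolynomial.idealOfVars σ A).map ((Ideal.Quotient.mkₐ A (RingHom.ker π ^ k)).comp
      (MvPolynomial.aeval x)) = (RingHom.ker π).map (Ideal.Quotient.mkₐ A (RingHom.ker π ^ k)) := by
    rw [← hx, ← map_aeval_idealOfVars (A := A), Ideal.map_mapₐ]
  refine AlgHom.surjective_of_isNilpotent_map _ (MvPolynomial.idealOfVars σ A) ⟨k, ?_⟩ fun c ↦ ?_
  · rw [hmap, ← Ideal.map_pow]
    exact Ideal.map_quotient_self _
  · obtain ⟨r, rfl⟩ := Ideal.Quotient.mk_surjective c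
    refine ⟨π r, ?_⟩
    rw [hmap]
    have : r - algebraMap A R (π r) ∈ RingHom.ker π := by simp [RingHom.mem_ker]
    simpa using Ideal.mem_map_of_mem (Ideal.Quotient.mkₐ A (RingHom.ker π ^ k)) this

/-- Generators of the kernel of a retraction `R → A` that satisfy no polynomial relation over `A`
to any order form a weakly regular sequence. -/
theorem isWeaklyRegular_of_mem_pow_idealOfVars [IsLocalRing R] [IsNoetherianRing R] [Nontrivial A]
    {n : ℕ} {x : Fin n → R} (hx : Ideal.span (Set.range x) = RingHom.ker π)
    (h : ∀ (k : ℕ) (f : MvPolynomial (Fin n) A),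
      MvPolynomial.aeval x f ∈ RingHom.ker π ^ (k + 2) →
        f ∈ MvPolynomial.idealOfVars (Fin n) A ^ (k + 2)) :
    RingTheory.Sequence.IsWeaklyRegular R (List.ofFn x) := by
  rw [RingTheory.Sequence.isWeaklyRegular_iff]
  intro i hi
  have hin : i < n := by simpa using hi
  set s : Set (Fin n) := {j | j.1 < i} with hs
  have hofList : Ideal.ofList ((List.ofFn x).take i) = Ideal.span (x '' s) := by
    rw [Ideal.ofList]
    congr 1
    ext r
    simp only [List.mem_take_iff_getElem, Set.mem_ofPred_eq, Set.mem_image, hs]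
    constructor
    · rintro ⟨j, hj, rfl⟩
      simp only [List.length_ofFn, lt_min_iff] at hj
      exact ⟨⟨j, hj.2⟩, hj.1, by simp⟩
    · rintro ⟨j, hj, rfl⟩
      exact ⟨j, by simp [hj], by simp⟩
  rw [isSMulRegular_iff_right_eq_zero_of_smul]
  intro q hq
  obtain ⟨r, rfl⟩ := Submodule.Quotient.mk_surjective _ q
  rw [← Submodule.Quotient.mk_smul, Submodule.Quotient.mk_eq_zero] at hq
  rw [Submodule.Quotient.mk_eq_zero]
  simp only [smul_eq_mul, Ideal.mul_top, hofList, List.getElem_ofFn] at hq ⊢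
  set a : Ideal R := Ideal.span (x '' s)
  have hapx : ∀ k : ℕ, r ∈ a ⊔ RingHom.ker π ^ (k + 1) := by
    intro k
    set ρ := (Ideal.Quotient.mkₐ A (RingHom.ker π ^ (k + 2))).comp
      (MvPolynomial.aeval x : MvPolynomial (Fin n) A →ₐ[A] R) with hρ
    have hsurj : Function.Surjective ρ := mkₐ_comp_aeval_surjective π hx (k + 2)
    have hmap : (Ideal.span (MvPolynomial.X '' s)).map
        (MvPolynomial.aeval x : MvPolynomial (Fin n) A →ₐ[A] R) = a := by
      rw [Ideal.map_span, ← Set.image_comp]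
      simp [a]
    have hker : RingHom.ker ρ ≤ MvPolynomial.idealOfVars (Fin n) A ^ (k + 2) := by
      intro f hf
      exact h k f (Ideal.Quotient.eq_zero_iff_mem.mp hf)
    obtain ⟨g, hg⟩ := hsurj (Ideal.Quotient.mk _ r)
    have hmem : MvPolynomial.X ⟨i, hin⟩ * g ∈
        ((Ideal.span (MvPolynomial.X '' s)).map ρ).comap ρ := by
      rw [Ideal.mem_comap, map_mul, hg, ← Ideal.map_mapₐ, hmap]
      have := Ideal.mem_map_of_mem (Ideal.Quotient.mkₐ A (RingHom.ker π ^ (k + 2))) hq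
      simpa [hρ] using this
    rw [Ideal.comap_map_of_surjective' _ hsurj] at hmem
    have hmem' := MvPolynomial.mem_of_X_mul_mem_span_X_sup_pow_idealOfVars (i := ⟨i, hin⟩)
      (s := s) (by simp [hs]) (sup_le_sup_left hker _ hmem)
    have h1 := Ideal.mem_map_of_mem (MvPolynomial.aeval x : MvPolynomial (Fin n) A →ₐ[A] R) hmem'
    rw [Ideal.map_sup, hmap, Ideal.map_pow, map_aeval_idealOfVars, hx] at h1
    have h2 : r - MvPolynomial.aeval x g ∈ RingHom.ker π ^ (k + 2) :=
      Ideal.Quotient.eq.mp hg.symm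
    have h3 := add_mem (Ideal.mem_sup_right (S := a) (Ideal.pow_le_pow_right (by omega) h2)) h1
    simpa using h3
  have hker_ne : RingHom.ker π ≠ ⊤ := RingHom.ker_ne_top _
  have hbot := Ideal.iInf_pow_smul_eq_bot_of_isLocalRing (M := R ⧸ a) _ hker_ne
  rw [← Ideal.Quotient.eq_zero_iff_mem, ← Submodule.mem_bot R, ← hbot, Submodule.mem_iInf]
  intro k
  have hk : r ∈ a ⊔ RingHom.ker π ^ k :=
    (sup_le_sup_left (Ideal.pow_le_pow_right (I := RingHom.ker π) (Nat.le_succ k)) a) (hapx k)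
  obtain ⟨u, hu, v, hv, rfl⟩ := Submodule.mem_sup.mp hk
  rw [map_add, Ideal.Quotient.eq_zero_iff_mem.mpr hu, zero_add]
  have := Submodule.smul_mem_smul hv (Submodule.mem_top (x := (1 : R ⧸ a)))
  rwa [Algebra.smul_def, mul_one] at this


theorem isUnit_mk_of_isUnit_constantCoeff {k : ℕ} {f : MvPolynomial σ A}
    (hf : IsUnit (MvPolynomial.constantCoeff f)) :
    IsUnit (Ideal.Quotient.mk (MvPolynomial.idealOfVars σ A ^ k) f) := by
  have hmem : f - MvPolynomial.C (MvPolynomial.constantCoeff f) ∈ MvPolynomial.idealOfVars σ A := by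
    simp [MvPolynomial.mem_idealOfVars_iff_constantCoeff]
  have hnil : IsNilpotent (Ideal.Quotient.mk (MvPolynomial.idealOfVars σ A ^ k)
      (f - MvPolynomial.C (MvPolynomial.constantCoeff f))) := by
    refine ⟨k, ?_⟩
    rw [← map_pow, Ideal.Quotient.eq_zero_iff_mem]
    exact Ideal.pow_mem_pow hmem k
  have hu := (hf.map (MvPolynomial.C (σ := σ))).map
    (Ideal.Quotient.mk (MvPolynomial.idealOfVars σ A ^ k))
  have := hnil.isUnit_add_left_of_commute hu (Commute.all _ _)
  rwa [← map_add, add_sub_cancel] at this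

instance [Finite σ] (k : ℕ) :
    Module.Finite A (MvPolynomial σ A ⧸ MvPolynomial.idealOfVars σ A ^ k) := by
  have : Algebra.IsIntegral A (MvPolynomial σ A ⧸ MvPolynomial.idealOfVars σ A ^ k) := by
    refine ⟨fun b ↦ ?_⟩
    obtain ⟨f, rfl⟩ := Ideal.Quotient.mk_surjective b
    have hmem : f - algebraMap A _ (MvPolynomial.constantCoeff f) ∈
        MvPolynomial.idealOfVars σ A := by
      simp [MvPolynomial.mem_idealOfVars_iff_constantCoeff, MvPolynomial.algebraMap_eq]
    have hint : IsIntegral A (Ideal.Quotient.mk (MvPolynomial.idealOfVars σ A ^ k)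
        (f - algebraMap A _ (MvPolynomial.constantCoeff f))) := by
      refine IsIntegral.of_pow k.succ_pos ?_
      rw [← map_pow, Ideal.Quotient.eq_zero_iff_mem.mpr
        (Ideal.pow_le_pow_right k.le_succ (Ideal.pow_mem_pow hmem _))]
      exact isIntegral_zero
    have := hint.add (isIntegral_algebraMap (x := MvPolynomial.constantCoeff f))
    rwa [map_sub, Ideal.Quotient.mk_algebraMap, sub_add_cancel] at this
  exact Algebra.IsIntegral.finite

/-- For a formally smooth retraction `R → A` onto a local ring, minimal generators of the kernel
satisfy no polynomial relation to any order. -/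
theorem mem_pow_idealOfVars_of_formallySmooth [IsLocalRing A] [Algebra.FormallySmooth A R]
    [Finite σ] (hx : Ideal.span (Set.range x) = RingHom.ker π)
    (hmin : ∀ g : MvPolynomial σ A, g ∈ MvPolynomial.idealOfVars σ A →
      MvPolynomial.aeval x g ∈ RingHom.ker π ^ 2 →
      g ∈ (IsLocalRing.maximalIdeal A).comap MvPolynomial.constantCoeff *
        MvPolynomial.idealOfVars σ A)
    {k : ℕ} (hk : 2 ≤ k) {f : MvPolynomial σ A}
    (hf : MvPolynomial.aeval x f ∈ RingHom.ker π ^ k) :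
    f ∈ MvPolynomial.idealOfVars σ A ^ k := by
  set J := RingHom.ker π with hJ
  set V := MvPolynomial.idealOfVars σ A with hV
  set B := MvPolynomial σ A ⧸ V ^ k
  set ev : MvPolynomial σ A →ₐ[A] R := MvPolynomial.aeval x with hev
  have hx0 : ∀ i, π (x i) = 0 := fun i ↦ by
    rw [← RingHom.mem_ker, ← hJ, ← hx]
    exact Ideal.subset_span ⟨i, rfl⟩
  have hVJ : V.map ev = J := by rw [map_aeval_idealOfVars, hx]
  have hVn : V.map (Ideal.Quotient.mk (V ^ k)) ^ k = ⊥ := by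
    rw [← Ideal.map_pow]
    exact Ideal.map_quotient_self _
  let κ : B →ₐ[A] R ⧸ J ^ 2 :=
    Ideal.Quotient.liftₐ (V ^ k) ((Ideal.Quotient.mkₐ A (J ^ 2)).comp ev) fun g hg ↦ by
      refine Ideal.Quotient.eq_zero_iff_mem.mpr ?_
      rw [← hVJ, ← Ideal.map_pow]
      exact Ideal.mem_map_of_mem _ (Ideal.pow_le_pow_right hk hg)
  have hκ (g) : κ (Ideal.Quotient.mk _ g) = Ideal.Quotient.mk _ (ev g) := rfl
  have hκs : Function.Surjective κ := fun c ↦ by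
    obtain ⟨g, hg⟩ := mkₐ_comp_aeval_surjective π hx 2 c
    exact ⟨Ideal.Quotient.mk _ g, hg⟩
  have hev_mem (g) : ev g ∈ J ↔ g ∈ V := aeval_mem_ker_iff π hx0 g
  have hκn : IsNilpotent (RingHom.ker κ) := by
    refine ⟨k, le_bot_iff.mp (hVn ▸ Ideal.pow_right_mono (fun b hb ↦ ?_) k)⟩
    obtain ⟨g, rfl⟩ := Ideal.Quotient.mk_surjective b
    refine Ideal.mem_map_of_mem _ ((hev_mem g).mp (Ideal.pow_le_self two_ne_zero ?_))
    exact Ideal.Quotient.eq_zero_iff_mem.mp hb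
  let φ : R →ₐ[A] B :=
    Algebra.FormallySmooth.liftOfSurjective (Ideal.Quotient.mkₐ A (J ^ 2)) κ hκs hκn
  have hφ (r g) (h : φ r = Ideal.Quotient.mk _ g) : ev g - r ∈ J ^ 2 := by
    rw [← Ideal.Quotient.eq, ← hκ, ← h]
    exact Algebra.FormallySmooth.liftOfSurjective_apply _ κ hκs hκn r
  have hφJ : J.map φ ≤ V.map (Ideal.Quotient.mk (V ^ k)) := by
    refine Ideal.map_le_iff_le_comap.mpr fun r hr ↦ ?_
    obtain ⟨g, hg⟩ := Ideal.Quotient.mk_surjective (φ r)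
    rw [Ideal.mem_comap, ← hg]
    refine Ideal.mem_map_of_mem _ ((hev_mem g).mp ?_)
    simpa using add_mem (Ideal.pow_le_self two_ne_zero (hφ r g hg.symm)) hr
  set N := (IsLocalRing.maximalIdeal A).comap (MvPolynomial.constantCoeff (σ := σ)) with hN
  have hjac : N.map (Ideal.Quotient.mk (V ^ k)) ≤ Ideal.jacobson ⊥ := by
    refine Ideal.map_le_iff_le_comap.mpr fun g hg ↦ ?_
    rw [Ideal.mem_comap, Ideal.mem_jacobson_bot]
    intro c
    obtain ⟨h, rfl⟩ := Ideal.Quotient.mk_surjective c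
    rw [← map_mul, ← map_one (Ideal.Quotient.mk (V ^ k)), ← map_add]
    refine isUnit_mk_of_isUnit_constantCoeff ?_
    by_contra hu
    have h1 : MvPolynomial.constantCoeff (g * h + 1) ∈ IsLocalRing.maximalIdeal A := hu
    rw [map_add, map_mul, map_one] at h1
    have h2 := Ideal.mul_mem_right (MvPolynomial.constantCoeff h) _ (Ideal.mem_comap.mp hg)
    exact (IsLocalRing.maximalIdeal.isMaximal A).ne_top
      ((Ideal.eq_top_iff_one _).mpr (((Ideal.add_mem_iff_right _ h2).mp h1)))
  have hφV : V.map (Ideal.Quotient.mk (V ^ k)) ≤ J.map φ := by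
    refine Submodule.le_of_le_smul_of_le_jacobson_bot
      ((MvPolynomial.idealOfVars_fg σ A).map _) hjac ?_
    refine Ideal.map_le_iff_le_comap.mpr (Ideal.span_le.mpr ?_)
    rintro _ ⟨i, rfl⟩
    obtain ⟨g, hg⟩ := Ideal.Quotient.mk_surjective (φ (x i))
    have hg' := hφ _ _ hg.symm
    have hxi : x i ∈ J := hx0 i
    have hgV : g ∈ V := (hev_mem g).mp
      (by simpa using add_mem (Ideal.pow_le_self two_ne_zero hg') hxi)
    have h1 : g - MvPolynomial.X i ∈ N * V := by
      refine hmin _ (sub_mem hgV (Ideal.subset_span ⟨i, rfl⟩)) ?_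
      simpa [hev] using hg'
    have h2 := Ideal.mem_map_of_mem (Ideal.Quotient.mk (V ^ k)) h1
    rw [Ideal.map_mul, map_sub, hg] at h2
    have h3 := sub_mem (Ideal.mem_sup_left (Ideal.mem_map_of_mem φ hxi)) (Ideal.mem_sup_right h2)
    simpa using h3
  have hJV : J.map φ = V.map (Ideal.Quotient.mk (V ^ k)) := le_antisymm hφJ hφV
  have hφev : V.map (φ.comp ev) = V.map (Ideal.Quotient.mk (V ^ k)) := by
    rw [← Ideal.map_mapₐ, hVJ, hJV]
  have hsurj : Function.Surjective (φ.comp ev) := by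
    refine AlgHom.surjective_of_isNilpotent_map _ V ⟨k, by rw [hφev, hVn]; rfl⟩ fun c ↦ ?_
    obtain ⟨g, rfl⟩ := Ideal.Quotient.mk_surjective c
    refine ⟨MvPolynomial.constantCoeff g, ?_⟩
    rw [hφev, ← Ideal.Quotient.mk_algebraMap, ← map_sub]
    refine Ideal.mem_map_of_mem _ ?_
    simp [hV, MvPolynomial.mem_idealOfVars_iff_constantCoeff, MvPolynomial.algebraMap_eq]
  have hφk (r) (hr : r ∈ J ^ k) : φ r = 0 := by
    rw [← Submodule.mem_bot B, ← hVn, ← hJV, ← Ideal.map_pow]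
    exact Ideal.mem_map_of_mem _ hr
  let ψ : B →ₐ[A] B := Ideal.Quotient.liftₐ (V ^ k) (φ.comp ev) fun g hg ↦ by
    refine hφk _ ?_
    rw [← hVJ, ← Ideal.map_pow]
    exact Ideal.mem_map_of_mem _ hg
  have hψs : Function.Surjective ψ.toLinearMap := fun c ↦ by
    obtain ⟨g, hg⟩ := hsurj c
    exact ⟨Ideal.Quotient.mk _ g, hg⟩
  have hψi := OrzechProperty.injective_of_surjective_endomorphism ψ.toLinearMap hψs
  have h0 : ψ.toLinearMap (Ideal.Quotient.mk _ f) = ψ.toLinearMap 0 := by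
    rw [map_zero]
    exact hφk _ hf
  exact Ideal.Quotient.eq_zero_iff_mem.mp (hψi h0)

/-- The kernel of a formally smooth retraction of local rings is generated by a regular sequence
when the source is noetherian. -/
theorem exists_isRegular_of_formallySmooth [IsLocalRing A] [IsLocalRing R] [IsNoetherianRing R]
    [Algebra.FormallySmooth A R] :
    ∃ rs : List R, RingTheory.Sequence.IsRegular R rs ∧ Ideal.ofList rs = RingHom.ker π := by
  classical
  set J := RingHom.ker π with hJ
  have hJm : J ≤ IsLocalRing.maximalIdeal R := IsLocalRing.le_maximalIdeal (RingHom.ker_ne_top _)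
  have hJfg : Submodule.FG J := IsNoetherian.noetherian J
  obtain ⟨t, htc, ht⟩ := hJfg.exists_span_finset_card_eq_spanFinrank
  set n := Submodule.spanFinrank J
  let e : t ≃ Fin n := t.equivFinOfCardEq htc
  let x : Fin n → R := fun i ↦ (e.symm i).1
  have hx : Ideal.span (Set.range x) = J := by
    rw [← ht]
    congr 1
    ext r
    exact ⟨fun ⟨i, hi⟩ ↦ hi ▸ (e.symm i).2, fun hr ↦ ⟨e ⟨r, hr⟩, by simp [x]⟩⟩
  have hx0 : ∀ i, π (x i) = 0 := fun i ↦ by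
    rw [← RingHom.mem_ker, ← hJ, ← hx]
    exact Ideal.subset_span ⟨i, rfl⟩
  have hrs : Ideal.ofList (List.ofFn x) = J := by
    rw [← hx, Ideal.ofList]
    congr 1
    ext r
    simp
  have hweak : RingTheory.Sequence.IsWeaklyRegular R (List.ofFn x) := by
    refine isWeaklyRegular_of_mem_pow_idealOfVars π hx fun k f hf ↦
      mem_pow_idealOfVars_of_formallySmooth π hx (fun g hg hgJ ↦ ?_) (by omega) hf
    obtain ⟨c, rfl⟩ := Ideal.mem_span_range_iff_exists_fun.mp hg
    refine Ideal.sum_mem _ fun j _ ↦ Ideal.mul_mem_mul ?_ (Ideal.subset_span ⟨j, rfl⟩)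
    rw [Ideal.mem_comap]
    by_contra hj
    have hcj : IsUnit (MvPolynomial.aeval x (c j)) := by
      by_contra hu
      have h1 : c j - MvPolynomial.C (MvPolynomial.constantCoeff (c j)) ∈
          MvPolynomial.idealOfVars (Fin n) A := by
        simp [MvPolynomial.mem_idealOfVars_iff_constantCoeff]
      have h2 := hJm ((aeval_mem_ker_iff π hx0 _).mpr h1)
      rw [map_sub, MvPolynomial.aeval_C] at h2
      have h3 := sub_mem (show _ ∈ IsLocalRing.maximalIdeal R from hu) h2
      rw [sub_sub_cancel] at h3
      exact h3 ((not_not.mp hj : IsUnit _).map (algebraMap A R))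
    have hmem (i) : x i ∈ J := hx0 i
    set s : Set (Fin n) := {i | i ≠ j} with hs
    have hothers (i) (hi : i ≠ j) : x i ∈ Ideal.span (x '' s) := Ideal.subset_span ⟨i, hi, rfl⟩
    have hJle : J ≤ Ideal.span (x '' s) := by
      refine Submodule.le_of_le_smul_of_le_jacobson_bot hJfg
        (hJm.trans (IsLocalRing.maximalIdeal_le_jacobson _)) ?_
      nth_rw 1 [← hx]
      rw [Ideal.span_le]
      rintro _ ⟨i, rfl⟩
      by_cases hi : i = j
      · subst hi
        rw [map_sum, ← Finset.add_sum_erase _ _ (Finset.mem_univ i)] at hgJ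
        have hsum : ∑ l ∈ Finset.univ.erase i, MvPolynomial.aeval x (c l * MvPolynomial.X l) ∈
            Ideal.span (x '' s) := by
          refine Ideal.sum_mem _ fun l hl ↦ ?_
          rw [map_mul, MvPolynomial.aeval_X]
          exact Ideal.mul_mem_left _ _ (hothers l (Finset.ne_of_mem_erase hl))
        rw [pow_two, ← smul_eq_mul] at hgJ
        have := sub_mem (Ideal.mem_sup_right hgJ) (Ideal.mem_sup_left hsum)
        rw [add_sub_cancel_right, map_mul, MvPolynomial.aeval_X] at this
        exact (Ideal.unit_mul_mem_iff_mem _ hcj).mp this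
      · exact Ideal.mem_sup_left (hothers i hi)
    have hJeq : J = Ideal.span (x '' s) := le_antisymm hJle
      (Ideal.span_le.mpr (by rintro _ ⟨i, -, rfl⟩; exact hmem i))
    have hle : n ≤ (x '' s).ncard := by
      have := Submodule.spanFinrank_span_le_ncard_of_finite (R := R) (Set.toFinite (x '' s))
      rwa [← Ideal.span, ← hJeq] at this
    have hlt : s.ncard < n := by
      have := Set.ncard_lt_card (s := s) (fun h ↦ (h ▸ Set.mem_univ j : j ∈ s) rfl)
      simpa using this
    exact absurd (hle.trans (Set.ncard_image_le (Set.toFinite s))) hlt.not_ge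
  refine ⟨List.ofFn x, ?_, hrs⟩
  refine (IsLocalRing.isRegular_iff_isWeaklyRegular_of_subset_maximalIdeal fun r hr ↦ ?_).mpr hweak
  exact hJm (hrs ▸ Ideal.subset_span hr)

end Retraction

/-- The kernel of a retraction of a formally smooth algebra onto its base is locally generated by
a regular sequence. -/
theorem exists_isRegular_localization_of_formallySmooth {P S : Type*} [CommRing P] [CommRing S]
    [Algebra P S] [IsNoetherianRing S] [Algebra.FormallySmooth P S] (μ : S →ₐ[P] P)
    (𝔪 : Ideal S) [𝔪.IsPrime] (hle : RingHom.ker μ ≤ 𝔪) :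
    ∃ rs : List (Localization.AtPrime 𝔪),
      RingTheory.Sequence.IsRegular (Localization.AtPrime 𝔪) rs ∧
      Ideal.ofList rs = (RingHom.ker μ).map (algebraMap S (Localization.AtPrime 𝔪)) := by
  set p : Ideal P := 𝔪.comap (algebraMap P S) with hp
  have h𝔪 : 𝔪 = p.comap (μ : S →+* P) := by
    ext s
    have h : s - algebraMap P S (μ s) ∈ 𝔪 := hle (by simp [RingHom.mem_ker])
    rw [Ideal.mem_comap, hp, Ideal.mem_comap]
    exact ⟨fun hs ↦ by simpa using sub_mem hs h, fun hs ↦ by simpa using add_mem h hs⟩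
  set A := Localization.AtPrime p
  set R := Localization.AtPrime 𝔪
  let ι : A →+* R := Localization.localRingHom p 𝔪 (algebraMap P S) rfl
  let ρ : R →+* A := Localization.localRingHom 𝔪 p (μ : S →+* P) h𝔪
  let : Algebra A R := ι.toAlgebra
  have hι (a : P) : algebraMap A R (algebraMap P A a) = algebraMap S R (algebraMap P S a) :=
    Localization.localRingHom_to_map p 𝔪 (algebraMap P S) rfl a
  have hρ (s : S) : ρ (algebraMap S R s) = algebraMap P A (μ s) :=
    Localization.localRingHom_to_map 𝔪 p (μ : S →+* P) h𝔪 s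
  have : IsScalarTower P A R := IsScalarTower.of_algebraMap_eq fun a ↦ by
    rw [hι, ← IsScalarTower.algebraMap_apply]
  have : Algebra.FormallySmooth A R := Algebra.FormallySmooth.localization_base p.primeCompl
  have hcomp : ρ.comp (algebraMap A R) = RingHom.id A := by
    refine IsLocalization.ringHom_ext p.primeCompl (RingHom.ext fun a ↦ ?_)
    simp [hι, hρ]
  let π : R →ₐ[A] A := { ρ with commutes' := fun a ↦ RingHom.congr_fun hcomp a }
  obtain ⟨rs, hreg, hrs⟩ := exists_isRegular_of_formallySmooth π
  refine ⟨rs, hreg, hrs.trans (le_antisymm (fun r hr ↦ ?_) ?_)⟩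
  · obtain ⟨s, t, rfl⟩ := IsLocalization.exists_mk'_eq 𝔪.primeCompl r
    have hr0 : ρ (IsLocalization.mk' R s t) = 0 := hr
    have h0 : algebraMap P A (μ s) = 0 := by
      rw [← hρ, ← IsLocalization.mk'_spec R s t, map_mul, hr0, zero_mul]
    obtain ⟨u, hu⟩ := (IsLocalization.map_eq_zero_iff p.primeCompl A _).mp h0
    rw [IsLocalization.mk'_mem_map_algebraMap_iff]
    exact ⟨algebraMap P S u, u.2, by simp [RingHom.mem_ker, hu]⟩
  · refine Ideal.map_le_iff_le_comap.mpr fun s hs ↦ ?_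
    change ρ (algebraMap S R s) = 0
    rw [hρ, RingHom.mem_ker.mp hs, map_zero]

theorem stmt1 (K P : Type) [CommRing K] [CommRing P] [IsNoetherianRing K]
    [IsNoetherianRing P] [Algebra K P]
    (hflat : Module.Flat K P) (heft : Algebra.EssFiniteType K P)
    (hsm : EssentiallySmooth K P)
    (I : Ideal (P ⊗[K] P)) (hI : I = RingHom.ker (Algebra.TensorProduct.lmul' (S := P) K))
    (𝔪 : Ideal (P ⊗[K] P)) (h𝔪 : 𝔪.IsPrime) (hle : I ≤ 𝔪) :
    ∃ rs : List (Localization.AtPrime 𝔪),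
      RingTheory.Sequence.IsRegular (Localization.AtPrime 𝔪) rs ∧
      Ideal.span {x | x ∈ rs} =
        I.map (algebraMap (P ⊗[K] P) (Localization.AtPrime 𝔪)) := by
  have := hsm.2.2
  have : IsNoetherianRing (P ⊗[K] P) := Algebra.EssFiniteType.isNoetherianRing P (P ⊗[K] P)
  let μ : P ⊗[K] P →ₐ[P] P := Algebra.TensorProduct.lmul'' K
  have hμ : RingHom.ker μ = I := hI.symm
  obtain ⟨rs, hreg, hrs⟩ := exists_isRegular_localization_of_formallySmooth μ 𝔪 (hμ ▸ hle)
  exact ⟨rs, hreg, hμ ▸ hrs⟩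
end

section
/- Let K → P be a flat, essentially of finite type homomorphism of commutative noetherian rings. If the projective dimension of P over Pᵉ = P ⊗_K P is finite, then K → P is essentially smooth. -/
/-!
STATEMENT 2: If `K → P` is flat and essentially of finite type between commutative
noetherian rings, and `P` has finite projective dimension as a module over
`Pᵉ = P ⊗[K] P` (via the multiplication map), then `K → P` is essentially smooth.
-/

open CategoryTheory TensorProduct

/-- `M` has projective dimension at most `n` over `R`: there is a projective
resolution of `M` concentrated in degrees `0,…,n`. -/
def ProjDimLE (R : Type) [Ring R] (M : Type) [AddCommGroup M] [Module R M] (n : ℕ) : Prop :=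
  ∃ (F : ChainComplex (ModuleCat R) ℕ) (π : F ⟶ (ChainComplex.single₀ (ModuleCat R)).obj
      (ModuleCat.of R M)),
    (∀ i, Projective (F.X i)) ∧ (∀ i, n < i → Limits.IsZero (F.X i)) ∧ QuasiIso π

universe u

theorem mem_smul_top_of_one_tmul_eq_zero {R M : Type*} [CommRing R] [AddCommGroup M] [Module R M]
    (I : Ideal R) {m : M} (h : (1 : R ⧸ I) ⊗ₜ[R] m = 0) : m ∈ I • (⊤ : Submodule R M) := by
  have := congr(TensorProduct.quotTensorEquivQuotSMul M I $h)
  rwa [map_zero, show (1 : R ⧸ I) = Ideal.Quotient.mk I 1 from rfl,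
    TensorProduct.quotTensorEquivQuotSMul_mk_tmul, one_smul, Submodule.Quotient.mk_eq_zero] at this

theorem projDimLE_hasProjectiveDimensionLE {R : Type} [Ring R] {M : Type} [AddCommGroup M]
    [Module R M] {n : ℕ} (F : ChainComplex (ModuleCat R) ℕ)
    (π : F ⟶ (ChainComplex.single₀ (ModuleCat R)).obj (ModuleCat.of R M))
    (hF : ∀ i, Projective (F.X i)) (h0 : ∀ i, n < i → Limits.IsZero (F.X i)) (hπ : QuasiIso π) :
    HasProjectiveDimensionLE (ModuleCat.of R M) n := by
  refine HasProjectiveDimensionLT.mk ?_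
  intro i hi Y e
  let P : ProjectiveResolution (ModuleCat.of R M) := ⟨F, hF, π, hπ⟩
  obtain ⟨f, hf, rfl⟩ := P.extMk_surjective e (i + 1) rfl
  obtain rfl : f = 0 := (h0 i (by lia)).eq_of_src _ _
  exact P.extMk_zero _ _

theorem lTensor_exact_subtype_ker {R M N : Type*} [CommRing R] [AddCommGroup M] [AddCommGroup N]
    [Module R M] [Module R N] (S : Type*) [AddCommGroup S] [Module R S]
    (f : M →ₗ[R] N) (hf : Function.Surjective f) :
    Function.Exact ((LinearMap.ker f).subtype.lTensor S) (f.lTensor S) :=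
  lTensor_exact S f.exact_subtype_ker_map hf

section
variable {R : Type u} [CommRing R]

theorem hasProjectiveDimensionLT_baseChange (S : Type u) [CommRing S] [Algebra R S]
    (C : ModuleCat.{u} R → Prop)
    (hC : ∀ (F M : ModuleCat.{u} R) (f : F →ₗ[R] M), Module.Projective R F →
      Function.Surjective f → C M → C (ModuleCat.of R (LinearMap.ker f)) ∧
        Function.Injective ((LinearMap.ker f).subtype.lTensor S))
    (n : ℕ) (M : ModuleCat.{u} R) (hM : C M) (h : HasProjectiveDimensionLT M (n + 1)) :
    HasProjectiveDimensionLT (ModuleCat.of S (S ⊗[R] M)) (n + 1) := by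
  induction n generalizing M with
  | zero =>
    rw [zero_add, ← projective_iff_hasProjectiveDimensionLT_one, ← IsProjective.iff_projective]
      at h ⊢
    infer_instance
  | succ n ih =>
    let f : (M →₀ R) →ₗ[R] M := Finsupp.linearCombination R id
    have hf : Function.Surjective f := Finsupp.linearCombination_id_surjective R M
    have hP : Module.Projective R (M →₀ R) := inferInstance
    obtain ⟨hK, hinj⟩ := hC (ModuleCat.of R (M →₀ R)) M f hP hf hM
    have hs := LinearMap.shortExact_shortComplexKer hf
    have h1 := ih _ hK ((hs.hasProjectiveDimensionLT_X₃_iff n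
      ((IsProjective.iff_projective _).mp hP)).mp h)
    let T : ShortComplex (ModuleCat.{u} S) :=
      { X₁ := ModuleCat.of S (S ⊗[R] LinearMap.ker f)
        X₂ := ModuleCat.of S (S ⊗[R] (M →₀ R))
        X₃ := ModuleCat.of S (S ⊗[R] M)
        f := ModuleCat.ofHom ((LinearMap.ker f).subtype.baseChange S)
        g := ModuleCat.ofHom (f.baseChange S)
        zero := by
          rw [← ModuleCat.ofHom_comp, ← LinearMap.baseChange_comp]
          have : f ∘ₗ (LinearMap.ker f).subtype = 0 := by ext; simp
          rw [this, LinearMap.baseChange_zero]; rfl }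
    have hex : Function.Exact ((LinearMap.ker f).subtype.lTensor S) (f.lTensor S) :=
      lTensor_exact_subtype_ker S f hf
    have hT : T.ShortExact :=
      { exact := (ShortComplex.ShortExact.moduleCat_exact_iff_function_exact T).mpr
          hex
        mono_f := (ModuleCat.mono_iff_injective _).mpr hinj
        epi_g := (ModuleCat.epi_iff_surjective _).mpr (LinearMap.lTensor_surjective S hf) }
    refine (hT.hasProjectiveDimensionLT_X₃_iff n ((IsProjective.iff_projective _).mp ?_)).mpr h1
    change Module.Projective S (S ⊗[R] (M →₀ R))
    infer_instance

theorem hasProjectiveDimensionLT_baseChange_of_flat (S : Type u) [CommRing S] [Algebra R S]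
    [Module.Flat R S] (n : ℕ) (M : ModuleCat.{u} R) (h : HasProjectiveDimensionLT M (n + 1)) :
    HasProjectiveDimensionLT (ModuleCat.of S (S ⊗[R] M)) (n + 1) :=
  hasProjectiveDimensionLT_baseChange S (fun _ ↦ True)
    (fun _ _ _ _ _ _ ↦ ⟨trivial, Module.Flat.lTensor_preserves_injective_linearMap _
      (Submodule.subtype_injective _)⟩) n M trivial h

theorem hasProjectiveDimensionLT_quotSMulTop (x : R) (hx : IsSMulRegular R x)
    (n : ℕ) (M : ModuleCat.{u} R) (hM : IsSMulRegular M x)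
    (h : HasProjectiveDimensionLT M (n + 1)) :
    HasProjectiveDimensionLT (ModuleCat.of (R ⧸ Ideal.span {x}) ((R ⧸ Ideal.span {x}) ⊗[R] M))
      (n + 1) := by
  refine hasProjectiveDimensionLT_baseChange _ (fun M ↦ IsSMulRegular M x) ?_ n M hM h
  intro F M f hF hf hM
  have hxF : IsSMulRegular F x :=
    Module.Flat.isSMulRegular_of_isRegular ((isLeftRegular_iff_isRegular.mp hx))
  refine ⟨hxF.submodule (LinearMap.ker f) x, ?_⟩
  rw [injective_iff_map_eq_zero]
  intro z hz
  obtain ⟨k, rfl⟩ := TensorProduct.mk_surjective R (LinearMap.ker f) (R ⧸ Ideal.span {x})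
    Ideal.Quotient.mk_surjective z
  rw [TensorProduct.mk_apply, LinearMap.lTensor_tmul] at hz
  have hk := mem_smul_top_of_one_tmul_eq_zero _ hz
  rw [Submodule.ideal_span_singleton_smul, Submodule.mem_smul_pointwise_iff_exists] at hk
  obtain ⟨y, -, hy⟩ := hk
  have hyk : y ∈ LinearMap.ker f := by
    rw [LinearMap.mem_ker]
    refine hM.right_eq_zero_of_smul ?_
    rw [← map_smul, hy]
    exact k.2
  obtain rfl : k = x • (⟨y, hyk⟩ : LinearMap.ker f) := Subtype.ext hy.symm
  rw [TensorProduct.mk_apply, ← TensorProduct.smul_tmul,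
    Algebra.smul_def, Ideal.Quotient.algebraMap_eq, Ideal.Quotient.eq_zero_iff_mem.mpr
      (Ideal.mem_span_singleton_self x), zero_mul, TensorProduct.zero_tmul]

end

section
variable {B : Type u} [CommRing B] [IsLocalRing B]

open IsLocalRing

theorem free_of_hasProjectiveDimensionLT_of_smul_maximalIdeal_eq_zero [IsNoetherianRing B]
    {s : B} (hs : s ≠ 0) (hsm : ∀ y ∈ maximalIdeal B, s * y = 0) (n : ℕ)
    (M : ModuleCat.{u} B) [Module.Finite B M]
    (h : HasProjectiveDimensionLT M (n + 1)) : Module.Free B M := by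
  induction n generalizing M with
  | zero =>
    rw [zero_add, ← projective_iff_hasProjectiveDimensionLT_one, ← IsProjective.iff_projective]
      at h
    exact Module.free_of_flat_of_isLocalRing
  | succ n ih =>
    obtain ⟨r, f, hf⟩ := Module.Finite.exists_fin' B M
    have hS := LinearMap.shortExact_shortComplexKer hf
    have hK := ih (ModuleCat.of B (LinearMap.ker f)) ((hS.hasProjectiveDimensionLT_X₃_iff n
      ((IsProjective.iff_projective (Fin r → B)).mp inferInstance)).mp h)
    change Module.Free B (LinearMap.ker f) at hK
    refine Module.free_of_lTensor_residueField_injective (LinearMap.ker f).subtype f hf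
      f.exact_subtype_ker_map ?_
    rw [injective_iff_map_eq_zero]
    intro z hz
    obtain ⟨a, rfl⟩ := TensorProduct.mk_surjective B (LinearMap.ker f) (ResidueField B)
      IsLocalRing.residue_surjective z
    rw [TensorProduct.mk_apply, LinearMap.lTensor_tmul] at hz
    have ha := mem_smul_top_of_one_tmul_eq_zero (maximalIdeal B) hz
    have hsa : s • a = 0 := by
      refine Subtype.ext ?_
      change s • ((LinearMap.ker f).subtype a) = 0
      refine Submodule.smul_induction_on ha (fun y hy v _ ↦ ?_) (fun v w hv hw ↦ ?_)
      · rw [smul_smul, hsm y hy, zero_smul]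
      · rw [smul_add, hv, hw, add_zero]
    let b := Module.Free.chooseBasis B (LinearMap.ker f)
    have hmem : ∀ i, b.repr a i ∈ maximalIdeal B := by
      intro i
      rw [mem_maximalIdeal, mem_nonunits_iff]
      intro hu
      refine hs (hu.mul_left_eq_zero.mp ?_)
      simpa using congr(b.repr $hsa i)
    rw [TensorProduct.mk_apply, ← b.sum_repr a, TensorProduct.tmul_sum]
    refine Finset.sum_eq_zero fun i _ ↦ ?_
    rw [← TensorProduct.smul_tmul, Algebra.smul_def, ResidueField.algebraMap_eq,
      (residue_eq_zero_iff _).mpr (hmem i), zero_mul, TensorProduct.zero_tmul]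

theorem hasProjectiveDimensionLT_of_linearEquiv {R M N : Type u} [CommRing R] [AddCommGroup M]
    [AddCommGroup N] [Module R M] [Module R N] (e : M ≃ₗ[R] N) (n : ℕ)
    (h : HasProjectiveDimensionLT (ModuleCat.of R M) n) :
    HasProjectiveDimensionLT (ModuleCat.of R N) n :=
  hasProjectiveDimensionLT_of_iso e.toModuleIso n

theorem ker_linearMap_residueField :
    LinearMap.ker (Algebra.linearMap B (ResidueField B)) = maximalIdeal B := by
  ext x
  exact residue_eq_zero_iff x

theorem hasProjectiveDimensionLT_residueField_iff (n : ℕ) :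
    HasProjectiveDimensionLT (ModuleCat.of B (ResidueField B)) (n + 1 + 1) ↔
      HasProjectiveDimensionLT (ModuleCat.of B (maximalIdeal B)) (n + 1) := by
  have hs := LinearMap.shortExact_shortComplexKer (M := B) (N := ResidueField B)
    (f := Algebra.linearMap B (ResidueField B)) residue_surjective
  refine (hs.hasProjectiveDimensionLT_X₃_iff n
    ((IsProjective.iff_projective B).mp inferInstance)).trans ?_
  let e := LinearEquiv.ofEq _ _ (ker_linearMap_residueField (B := B))
  exact ⟨hasProjectiveDimensionLT_of_linearEquiv e _,
    hasProjectiveDimensionLT_of_linearEquiv e.symm _⟩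

theorem exists_regular_mem_maximalIdeal [IsNoetherianRing B] (hm : maximalIdeal B ≠ ⊥) (n : ℕ)
    (h : HasProjectiveDimensionLT (ModuleCat.of B (ResidueField B)) (n + 1)) :
    ∃ x ∈ maximalIdeal B, x ∉ maximalIdeal B ^ 2 ∧ IsSMulRegular B x := by
  classical
  by_contra! hx
  let s : Finset (Ideal B) := insert (maximalIdeal B ^ 2) (associatedPrimes.finite B B).toFinset
  have hsub : ((maximalIdeal B : Ideal B) : Set B) ⊆
      ⋃ i ∈ (↑s : Set (Ideal B)), (id i : Ideal B) := by
    intro y hy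
    by_cases hy2 : y ∈ maximalIdeal B ^ 2
    · exact Set.mem_biUnion (x := maximalIdeal B ^ 2) (by simp [s]) hy2
    · have hr := hx y hy hy2
      have hy3 : y ∈ ⋃ p ∈ associatedPrimes B B, (p : Set B) := by
        rw [biUnion_associatedPrimes_eq_zero_divisors]
        rw [isSMulRegular_iff_right_eq_zero_of_smul] at hr
        push Not at hr
        obtain ⟨z, hz, hz'⟩ := hr
        exact ⟨z, hz', hz⟩
      obtain ⟨p, hp, hyp⟩ := Set.mem_iUnion₂.mp hy3
      exact Set.mem_biUnion (x := p) (by simp [s, hp]) hyp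
  rw [Ideal.subset_union_prime (maximalIdeal B ^ 2) (maximalIdeal B ^ 2)] at hsub
  · obtain ⟨p, hp, hle⟩ := hsub
    rcases Finset.mem_insert.mp hp with rfl | hp
    · refine hm (Submodule.eq_bot_of_le_smul_of_le_jacobson_bot (maximalIdeal B) _
        (IsNoetherian.noetherian _) ?_ (IsLocalRing.maximalIdeal_le_jacobson _))
      rwa [smul_eq_mul, ← pow_two]
    · rw [Set.Finite.mem_toFinset, AssociatedPrimes.mem_iff, isAssociatedPrime_iff] at hp
      obtain ⟨hp, s, rfl⟩ := hp
      have hs : s ≠ 0 := by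
        rintro rfl
        exact hp.ne_top (by simp)
      have hsm : ∀ y ∈ maximalIdeal B, s * y = 0 := by
        intro y hy
        have := hle hy
        rw [id, Submodule.mem_colon_singleton, Submodule.mem_bot, smul_eq_mul] at this
        rw [mul_comm, this]
      have hfree := free_of_hasProjectiveDimensionLT_of_smul_maximalIdeal_eq_zero hs hsm n _ h
      change Module.Free B (ResidueField B) at hfree
      refine hm (eq_bot_iff.mpr fun y hy ↦ ?_)
      have : FaithfulSMul B (ResidueField B) := inferInstance
      rw [Ideal.mem_bot]
      refine FaithfulSMul.algebraMap_injective B (ResidueField B) ?_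
      rw [map_zero]
      exact (residue_eq_zero_iff y).mpr hy
  · intro i hi h1 _
    rw [Finset.mem_insert] at hi
    simp only [h1, false_or, Set.Finite.mem_toFinset] at hi
    exact hi.isPrime

theorem exists_linearMap_maximalIdeal {x : B} (hx : x ∈ maximalIdeal B)
    (hx2 : x ∉ maximalIdeal B ^ 2) :
    ∃ φ : maximalIdeal B →ₗ[B] ResidueField B, φ ⟨x, hx⟩ = 1 := by
  have hne : (maximalIdeal B).toCotangent ⟨x, hx⟩ ≠ 0 := by
    rwa [Ne, Ideal.toCotangent_eq_zero]
  obtain ⟨g, hg⟩ := Module.Projective.exists_dual_eq_one (ResidueField B) hne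
  exact ⟨(g.restrictScalars B) ∘ₗ (maximalIdeal B).toCotangent, hg⟩

end

theorem hasProjectiveDimensionLT_of_leftInverse {R M N : Type u} [CommRing R] [AddCommGroup M]
    [AddCommGroup N] [Module R M] [Module R N] (i : M →ₗ[R] N) (r : N →ₗ[R] M)
    (hri : ∀ m, r (i m) = m) (n : ℕ)
    (h : HasProjectiveDimensionLT (ModuleCat.of R N) n) :
    HasProjectiveDimensionLT (ModuleCat.of R M) n := by
  let ρ : Retract (ModuleCat.of R M) (ModuleCat.of R N) :=
    { i := ModuleCat.ofHom i
      r := ModuleCat.ofHom r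
      retract := by
        rw [← ModuleCat.ofHom_comp, show r ∘ₗ i = LinearMap.id from LinearMap.ext hri]
        rfl }
  exact ρ.hasProjectiveDimensionLT n

section
variable {B : Type u} [CommRing B] [IsLocalRing B]

open IsLocalRing

theorem exists_leftInverse_maximalIdeal_quotient {x : B} (hx : x ∈ maximalIdeal B)
    (hx2 : x ∉ maximalIdeal B ^ 2) [IsLocalRing (B ⧸ Ideal.span {x})] :
    ∃ (i : maximalIdeal (B ⧸ Ideal.span {x}) →ₗ[B ⧸ Ideal.span {x}]
        (B ⧸ Ideal.span {x}) ⊗[B] maximalIdeal B)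
      (r : (B ⧸ Ideal.span {x}) ⊗[B] maximalIdeal B →ₗ[B ⧸ Ideal.span {x}]
        maximalIdeal (B ⧸ Ideal.span {x})), ∀ m, r (i m) = m := by
  have hloc : IsLocalHom (Ideal.Quotient.mk (Ideal.span {x})) :=
    IsLocalHom.of_surjective _ Ideal.Quotient.mk_surjective
  have hcomap (y : B) : Ideal.Quotient.mk (Ideal.span {x}) y ∈
      maximalIdeal (B ⧸ Ideal.span {x}) ↔ y ∈ maximalIdeal B := by
    simp only [mem_maximalIdeal, mem_nonunits_iff, isUnit_map_iff]
  obtain ⟨φ, hφ⟩ := exists_linearMap_maximalIdeal hx hx2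
  set xm : maximalIdeal B := ⟨x, hx⟩ with hxm
  let l : maximalIdeal B →ₗ[B] maximalIdeal (B ⧸ Ideal.span {x}) :=
    { toFun y := ⟨Ideal.Quotient.mk _ y, (hcomap y).mpr y.2⟩
      map_add' _ _ := by ext; simp
      map_smul' _ _ := by ext; simp [Algebra.smul_def] }
  have hl : Function.Surjective l := by
    rintro ⟨y, hy⟩
    obtain ⟨y, rfl⟩ := Ideal.Quotient.mk_surjective y
    exact ⟨⟨y, (hcomap y).mp hy⟩, rfl⟩
  have hx0 (y : maximalIdeal B) : (y : B) • ((1 : B ⧸ Ideal.span {x}) ⊗ₜ[B] xm) = 0 := by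
    rw [← TensorProduct.tmul_smul, show (y : B) • xm = x • y from Subtype.ext (mul_comm _ _),
      ← TensorProduct.smul_tmul, Algebra.smul_def, Ideal.Quotient.algebraMap_eq,
      Ideal.Quotient.eq_zero_iff_mem.mpr (Ideal.mem_span_singleton_self x), zero_mul,
      TensorProduct.zero_tmul]
  let ε : ResidueField B →ₗ[B] (B ⧸ Ideal.span {x}) ⊗[B] maximalIdeal B :=
    Submodule.liftQ (maximalIdeal B) (LinearMap.toSpanSingleton B _ (1 ⊗ₜ xm))
      (fun y hy ↦ hx0 ⟨y, hy⟩)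
  have hε : ε 1 = 1 ⊗ₜ xm := (Submodule.liftQ_apply _ _ (1 : B)).trans (one_smul _ _)
  let j : maximalIdeal B →ₗ[B] (B ⧸ Ideal.span {x}) ⊗[B] maximalIdeal B :=
    TensorProduct.mk B _ _ 1 - ε ∘ₗ φ
  have hj : LinearMap.ker l ≤ LinearMap.ker j := by
    intro y hy
    have hy' : Ideal.Quotient.mk (Ideal.span {x}) y = 0 := congr(($hy).1)
    rw [Ideal.Quotient.eq_zero_iff_mem, Ideal.mem_span_singleton'] at hy'
    obtain ⟨b, hb⟩ := hy'
    obtain rfl : y = b • xm := Subtype.ext hb.symm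
    rw [LinearMap.mem_ker, map_smul, LinearMap.sub_apply, LinearMap.comp_apply, hφ, hε,
      TensorProduct.mk_apply, sub_self, smul_zero]
  let i : maximalIdeal (B ⧸ Ideal.span {x}) →ₗ[B] (B ⧸ Ideal.span {x}) ⊗[B] maximalIdeal B :=
    (LinearMap.ker l).liftQ j hj ∘ₗ (l.quotKerEquivOfSurjective hl).symm.toLinearMap
  have hi (y) : i (l y) = j y := by
    have : (l.quotKerEquivOfSurjective hl).symm (l y) = (LinearMap.ker l).mkQ y := by
      rw [LinearEquiv.symm_apply_eq]; rfl
    simp [i, this]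
  refine ⟨i.extendScalarsOfSurjective Ideal.Quotient.mk_surjective, l.liftBaseChange _, ?_⟩
  intro m
  obtain ⟨y, rfl⟩ := hl m
  rw [LinearMap.extendScalarsOfSurjective_apply, hi, LinearMap.sub_apply, map_sub]
  have h1 : ∀ c : ResidueField B, l.liftBaseChange (B ⧸ Ideal.span {x}) (ε c) = 0 := by
    intro c
    obtain ⟨c, rfl⟩ := residue_surjective c
    have : residue B c = c • 1 := by simp [Algebra.smul_def]
    have hlx : l xm = 0 := Subtype.ext (Ideal.Quotient.eq_zero_iff_mem.mpr
      (Ideal.mem_span_singleton_self x))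
    rw [this, map_smul, hε, ← TensorProduct.tmul_smul, LinearMap.liftBaseChange_tmul, map_smul, hlx]
    simp
  rw [LinearMap.comp_apply, h1, TensorProduct.mk_apply, LinearMap.liftBaseChange_tmul, one_smul,
    sub_zero]

theorem exists_hasProjectiveDimensionLT_residueField_quotient {x : B} (hx : x ∈ maximalIdeal B)
    (hx2 : x ∉ maximalIdeal B ^ 2) (hreg : IsSMulRegular B x)
    [IsLocalRing (B ⧸ Ideal.span {x})] (n : ℕ)
    (h : HasProjectiveDimensionLT (ModuleCat.of B (ResidueField B)) (n + 1)) :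
    ∃ n', HasProjectiveDimensionLT (ModuleCat.of (B ⧸ Ideal.span {x})
      (ResidueField (B ⧸ Ideal.span {x}))) (n' + 1) := by
  have h1 : HasProjectiveDimensionLT (ModuleCat.of B (maximalIdeal B)) (n + 1) :=
    (hasProjectiveDimensionLT_residueField_iff n).mp
      (hasProjectiveDimensionLT_of_ge _ (n + 1) _ (by lia))
  obtain ⟨i, r, hir⟩ := exists_leftInverse_maximalIdeal_quotient hx hx2
  exact ⟨n + 1, (hasProjectiveDimensionLT_residueField_iff n).mpr
    (hasProjectiveDimensionLT_of_leftInverse i r hir _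
      (hasProjectiveDimensionLT_quotSMulTop x hreg n _ (hreg.submodule _ x) h1))⟩

end

section

open IsLocalRing

theorem exists_mul_sub_mem_mul_ker {A B : Type*} [CommRing A] [CommRing B] (f : A →+* B)
    (n : Ideal A) [n.IsPrime] (hf : ∀ b : B, ∃ a, ∃ u ∉ n, f u * b = f a) (x : A) {z : A}
    (hz : z ∈ n * (Ideal.span {f x}).comap f) :
    ∃ v ∉ n, ∃ c ∈ n, v * z - x * c ∈ n * RingHom.ker f := by
  refine Submodule.mul_induction_on hz (fun a ha κ hκ ↦ ?_) (fun y z hy hz ↦ ?_)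
  · rw [Ideal.mem_comap, Ideal.mem_span_singleton'] at hκ
    obtain ⟨b, hb⟩ := hκ
    obtain ⟨c, u, hu, hc⟩ := hf b
    refine ⟨u, hu, a * c, n.mul_mem_right c ha, ?_⟩
    have : u * (a * κ) - x * (a * c) = a * (u * κ - x * c) := by ring
    rw [this]
    refine Ideal.mul_mem_mul ha ?_
    rw [RingHom.mem_ker, map_sub, map_mul, map_mul, ← hb, ← hc]
    ring
  · obtain ⟨v, hv, c, hc, h⟩ := hy
    obtain ⟨v', hv', c', hc', h'⟩ := hz
    refine ⟨v * v', fun hm ↦ (Ideal.IsPrime.mem_or_mem ‹_› hm).elim hv hv', v' * c + v * c',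
      add_mem (n.mul_mem_left _ hc) (n.mul_mem_left _ hc'), ?_⟩
    have : v * v' * (y + z) - x * (v' * c + v * c') =
      v' * (v * y - x * c) + v * (v' * z - x * c') := by ring
    rw [this]
    exact add_mem (Ideal.mul_mem_left _ _ h) (Ideal.mul_mem_left _ _ h')

theorem exists_mul_mem_mul_ker {A : Type*} [CommRing A] [IsNoetherianRing A] (B : Type u)
    [CommRing B] [IsNoetherianRing B] [IsLocalRing B] (f : A →+* B)
    (hf : ∀ b : B, ∃ a, ∃ u ∉ (maximalIdeal B).comap f, f u * b = f a) (n : ℕ)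
    (h : HasProjectiveDimensionLT (ModuleCat.of B (ResidueField B)) (n + 1)) {a : A}
    (ha : a ∈ RingHom.ker f) (ha2 : a ∈ (maximalIdeal B).comap f ^ 2) :
    ∃ u ∉ (maximalIdeal B).comap f, u * a ∈ (maximalIdeal B).comap f * RingHom.ker f := by
  generalize hI : RingHom.ker f = I
  induction I using WellFoundedGT.induction generalizing B n with
  | ind I ih =>
  subst hI
  by_cases hm : maximalIdeal B = ⊥
  · refine ⟨1, (Ideal.ne_top_iff_one _).mp (Ideal.IsPrime.ne_top inferInstance), ?_⟩
    rw [one_mul]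
    rwa [show RingHom.ker f = (maximalIdeal B).comap f from by rw [hm]; rfl,
      ← pow_two]
  obtain ⟨y, hy, hy2, hreg⟩ := exists_regular_mem_maximalIdeal hm n h
  obtain ⟨x, w, hw, hx⟩ := hf y
  have hwu : IsUnit (f w) := by simpa using hw
  obtain ⟨w', hw'⟩ := hwu
  have hxm : f x ∈ maximalIdeal B := hx ▸ Ideal.mul_mem_left _ _ hy
  have hxm2 : f x ∉ maximalIdeal B ^ 2 := by
    rwa [← hx, ← hw', Ideal.unit_mul_mem_iff_mem _ w'.isUnit]
  have hxreg : IsSMulRegular B (f x) := by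
    rw [← hx, ← hw']
    exact (w'.isUnit.isSMulRegular B).mul hreg
  have : Nontrivial (B ⧸ Ideal.span {f x}) :=
    Ideal.Quotient.nontrivial_iff.mpr fun htop ↦ (maximalIdeal.isMaximal B).ne_top
      (eq_top_iff.mpr (htop ▸ (Ideal.span_singleton_le_iff_mem _).mpr hxm))
  have : IsLocalRing (B ⧸ Ideal.span {f x}) :=
    .of_surjective' _ Ideal.Quotient.mk_surjective
  have hloc : IsLocalHom (Ideal.Quotient.mk (Ideal.span {f x})) :=
    IsLocalHom.of_surjective _ Ideal.Quotient.mk_surjective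
  obtain ⟨n', hn'⟩ := exists_hasProjectiveDimensionLT_residueField_quotient hxm hxm2 hxreg n h
  let f' := (Ideal.Quotient.mk (Ideal.span {f x})).comp f
  have hcomap : (maximalIdeal (B ⧸ Ideal.span {f x})).comap f' = (maximalIdeal B).comap f := by
    rw [← Ideal.comap_comap,
      ((local_hom_TFAE (Ideal.Quotient.mk (Ideal.span {f x}))).out 0 4 rfl rfl).mp hloc]
  have hker : RingHom.ker f' = (Ideal.span {f x}).comap f := by
    rw [← RingHom.comap_ker, Ideal.mk_ker]
  have hlt : RingHom.ker f < RingHom.ker f' := by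
    refine lt_of_le_of_ne (fun z hz ↦ ?_) fun heq ↦ ?_
    · rw [RingHom.mem_ker] at hz
      rw [RingHom.mem_ker, RingHom.comp_apply, hz, map_zero]
    · have hx' : x ∈ RingHom.ker f' := by
        rw [hker]
        exact Ideal.mem_span_singleton_self _
      rw [← heq, RingHom.mem_ker] at hx'
      exact hxm2 (hx' ▸ zero_mem _)
  obtain ⟨u, hu, hua⟩ := ih _ hlt _ f' (by
    intro b
    obtain ⟨b, rfl⟩ := Ideal.Quotient.mk_surjective b
    obtain ⟨a, u, hu, h⟩ := hf b
    exact ⟨a, u, hcomap ▸ hu, by simp only [f', RingHom.comp_apply, ← map_mul, h]⟩) n' hn'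
    (hlt.le ha) (hcomap ▸ ha2) rfl
  rw [hcomap, hker] at hua
  rw [hcomap] at hu
  obtain ⟨v, hv, c, hc, hvc⟩ := exists_mul_sub_mem_mul_ker f _ hf x hua
  refine ⟨v * u, fun hm ↦ (Ideal.IsPrime.mem_or_mem inferInstance hm).elim hv hu, ?_⟩
  have hcker : c ∈ RingHom.ker f := by
    have h0 := Ideal.mul_le_right hvc
    rw [RingHom.mem_ker] at ha h0
    rw [map_sub, map_mul, map_mul, map_mul, ha, mul_zero, mul_zero, zero_sub, neg_eq_zero] at h0
    exact hxreg.right_eq_zero_of_smul h0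
  have := add_mem hvc (Ideal.mul_mem_mul (show x ∈ (maximalIdeal B).comap f from hxm) hcker)
  rwa [sub_add_cancel, ← mul_assoc] at this

end

theorem flat_ker_of_flat {R M N : Type*} [CommRing R] [AddCommGroup M] [AddCommGroup N]
    [Module R M] [Module R N] [Module.Flat R M] [Module.Flat R N] (f : M →ₗ[R] N)
    (hf : Function.Surjective f) : Module.Flat R (LinearMap.ker f) := by
  rw [Module.Flat.iff_rTensor_preserves_injective_linearMap]
  intro A B _ _ _ _ g hg
  have h1 := Module.Flat.rTensor_preserves_injective_linearMap (M := M) g hg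
  have h2 := LinearMap.lTensor_injective_of_exact_of_flat f hf (LinearMap.ker f).subtype
    (Submodule.subtype_injective _) f.exact_subtype_ker_map A
  have h3 := h1.comp h2
  rw [← LinearMap.coe_comp, LinearMap.rTensor_comp_lTensor, ← LinearMap.lTensor_comp_rTensor,
    LinearMap.coe_comp] at h3
  exact h3.of_comp

theorem hasProjectiveDimensionLT_baseChange_of_isPushout {P R L : Type u} [CommRing P] [CommRing R]
    [CommRing L] [Algebra P R] [Algebra P L] (S : Type u) [CommRing S] [Algebra R S]
    [Algebra L S] [Algebra P S] [IsScalarTower P R S] [IsScalarTower P L S]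
    [Algebra.IsPushout P L R S] [Module.Flat P R] (M : Type u) [AddCommGroup M] [Module R M]
    [Module P M] [IsScalarTower P R M] [Module.Flat P M] (n : ℕ)
    (h : HasProjectiveDimensionLT (ModuleCat.of R M) (n + 1)) :
    HasProjectiveDimensionLT (ModuleCat.of S (S ⊗[R] M)) (n + 1) := by
  refine hasProjectiveDimensionLT_baseChange S
    (fun M ↦ ∃ (_ : Module P M) (_ : IsScalarTower P R M), Module.Flat P M) ?_ n _
    ⟨inferInstance, inferInstance, inferInstance⟩ h
  rintro F N f hF hf ⟨_, _, _⟩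
  let _ : Module P F := Module.compHom F (algebraMap P R)
  have : IsScalarTower P R F := .of_algebraMap_smul fun _ _ ↦ rfl
  have : Module.Flat P F := .trans P R F
  have hK : Module.Flat P (LinearMap.ker f) := flat_ker_of_flat (f.restrictScalars P) hf
  refine ⟨⟨inferInstance, inferInstance, hK⟩, ?_⟩
  have hinj := LinearMap.lTensor_injective_of_exact_of_flat (f.restrictScalars P) hf
    ((LinearMap.ker f).subtype.restrictScalars P) (Submodule.subtype_injective _)
    f.exact_subtype_ker_map L
  let eK := Algebra.IsPushout.cancelBaseChange P L R S (LinearMap.ker f)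
  let eF := Algebra.IsPushout.cancelBaseChange P L R S F
  have hcomm : ∀ z, (LinearMap.ker f).subtype.lTensor S (eK.symm z) =
      eF.symm (((LinearMap.ker f).subtype.restrictScalars P).lTensor L z) := by
    intro z
    induction z with
    | zero => simp only [map_zero]
    | add x y hx hy => simp only [map_add, hx, hy]
    | tmul x y => simp [eK, eF]
  have hcomp := (eF.symm.injective.comp hinj).comp eK.injective
  convert! hcomp using 1
  ext z
  simp [← hcomm]

/-- If `P` is cyclic with annihilator `J` and `J B` is the maximal ideal, then
`B ⊗[R] P` is the residue field of `B`, so bounds on its projective dimension transfer. -/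
theorem hasProjectiveDimensionLT_residueField_of_tensorProduct {R P B : Type u} [CommRing R]
    [CommRing P] [CommRing B] [Algebra R P] [Algebra R B] [IsLocalRing B]
    (hs : Function.Surjective (algebraMap R P))
    (hJ : (RingHom.ker (algebraMap R P)).map (algebraMap R B) = IsLocalRing.maximalIdeal B) (n : ℕ)
    (h : HasProjectiveDimensionLT (ModuleCat.of B (B ⊗[R] P)) n) :
    HasProjectiveDimensionLT (ModuleCat.of B (IsLocalRing.ResidueField B)) n := by
  let g : B →ₗ[B] B ⊗[R] P := LinearMap.toSpanSingleton B _ (1 ⊗ₜ 1)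
  have hg (b : B) : g b = b ⊗ₜ 1 := by simp [g, TensorProduct.smul_tmul']
  have hgs : Function.Surjective g := by
    intro z
    obtain ⟨b, rfl⟩ := Algebra.TensorProduct.includeLeft_surjective (R := R) (T := P) B B hs z
    exact ⟨b, hg b⟩
  have hker : LinearMap.ker g = IsLocalRing.maximalIdeal B := by
    let e : B ⊗[R] R ≃ₐ[R] B := Algebra.TensorProduct.rid R R B
    have h1 := Algebra.TensorProduct.lTensor_ker (A := B) (Algebra.ofId R P) hs
    have h2 : (RingHom.ker (Algebra.ofId R P)) = RingHom.ker (algebraMap R P) := rfl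
    rw [h2] at h1
    have h3 : ((e : B ⊗[R] R →+* B).comp
        (Algebra.TensorProduct.includeRight : R →ₐ[R] B ⊗[R] R).toRingHom) = algebraMap R B := by
      ext r
      simp [e, Algebra.algebraMap_eq_smul_one]
    rw [← hJ]
    ext b
    have h4 : b ∈ LinearMap.ker g ↔ b ⊗ₜ[R] (1 : R) ∈ RingHom.ker
        (Algebra.TensorProduct.map (AlgHom.id R B) (Algebra.ofId R P)) := by
      simp [hg, RingHom.mem_ker]
    rw [h4, h1]
    constructor
    · intro hb
      have := Ideal.mem_map_of_mem (e : B ⊗[R] R →+* B) hb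
      erw [Ideal.map_map, h3] at this
      simpa [e] using this
    · intro hb
      have : (e.symm : B →+* B ⊗[R] R).comp (algebraMap R B) =
          (Algebra.TensorProduct.includeRight : R →ₐ[R] B ⊗[R] R).toRingHom := by
        rw [← h3]; ext r; simp
      have h5 := Ideal.mem_map_of_mem (e.symm : B →+* B ⊗[R] R) hb
      rw [Ideal.map_map, this] at h5
      have h6 : e.symm b = b ⊗ₜ[R] (1 : R) := by simp [e]
      exact h6 ▸ h5
  exact hasProjectiveDimensionLT_of_linearEquiv ((g.quotKerEquivOfSurjective hgs).symm ≪≫ₗ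
    Submodule.quotEquivOfEq _ _ hker) n h

/-- The `L`-algebra map `L ⊗[K] S → L` extending the structure map `S → L`. -/
noncomputable def evalTensor (K S L : Type*) [CommRing K] [CommRing S] [CommRing L] [Algebra K S]
    [Algebra K L] [Algebra S L] [IsScalarTower K S L] : L ⊗[K] S →ₐ[L] L :=
  Algebra.TensorProduct.lift (AlgHom.id L L) (IsScalarTower.toAlgHom K S L) fun _ _ ↦ .all _ _

@[simp]
theorem evalTensor_tmul {K S L : Type*} [CommRing K] [CommRing S] [CommRing L] [Algebra K S]
    [Algebra K L] [Algebra S L] [IsScalarTower K S L] (c : L) (s : S) :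
    evalTensor K S L (c ⊗ₜ s) = c * algebraMap S L s := by
  simp [evalTensor]

theorem mem_ideal_of_evalTensor_eq_zero {K S L : Type*} [CommRing K] [CommRing S] [CommRing L]
    [Algebra K S] [Algebra K L] [Algebra S L] [IsScalarTower K S L] (I : Ideal (L ⊗[K] S))
    (hI : ∀ s : S, (1 : L) ⊗ₜ[K] s - algebraMap S L s ⊗ₜ 1 ∈ I) {z : L ⊗[K] S}
    (hz : evalTensor K S L z = 0) : z ∈ I := by
  have key (z : L ⊗[K] S) : z - evalTensor K S L z ⊗ₜ[K] (1 : S) ∈ I := by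
    induction z with
    | zero => simp
    | add x y hx hy =>
      rw [map_add, add_tmul, add_sub_add_comm]
      exact I.add_mem hx hy
    | tmul c s =>
      have := I.mul_mem_left (c ⊗ₜ[K] (1 : S)) (hI s)
      simpa [mul_sub] using this
  simpa [hz] using key z

theorem map_ker_lmul'_eq_ker_evalTensor {K P S L : Type*} [CommRing K] [CommRing P] [CommRing S]
    [CommRing L] [Algebra K P] [Algebra K S] [Algebra P S] [IsScalarTower K P S] [Algebra K L]
    [Algebra S L] [IsScalarTower K S L] [Algebra P L] [IsScalarTower K P L] [IsScalarTower P S L]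
    (M : Submonoid P) [IsLocalization M S] :
    (RingHom.ker (Algebra.TensorProduct.lmul' (S := P) K)).map
      (Algebra.TensorProduct.map (IsScalarTower.toAlgHom K P L) (IsScalarTower.toAlgHom K P S)) =
    RingHom.ker (evalTensor K S L) := by
  apply le_antisymm
  · rw [Ideal.map_le_iff_le_comap]
    intro z hz
    have h : (evalTensor K S L).toRingHom.comp (Algebra.TensorProduct.map
        (IsScalarTower.toAlgHom K P L) (IsScalarTower.toAlgHom K P S)).toRingHom =
        (algebraMap P L).comp (Algebra.TensorProduct.lmul' (S := P) K).toRingHom := by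
      ext p
      · simp
      · simp [← IsScalarTower.algebraMap_apply P S L]
    have h2 := congr($h z)
    rw [RingHom.mem_ker] at hz
    simpa [hz] using h2
  · intro z hz
    refine mem_ideal_of_evalTensor_eq_zero _ (fun s ↦ ?_) hz
    set J := (RingHom.ker (Algebra.TensorProduct.lmul' (S := P) K)).map
      (Algebra.TensorProduct.map (IsScalarTower.toAlgHom K P L) (IsScalarTower.toAlgHom K P S))
    have hp (p : P) : (1 : L) ⊗ₜ[K] algebraMap P S p - algebraMap P L p ⊗ₜ 1 ∈ J := by
      have : (1 : P) ⊗ₜ[K] p - p ⊗ₜ 1 ∈ RingHom.ker (Algebra.TensorProduct.lmul' (S := P) K) := by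
        simp [RingHom.mem_ker]
      have := Ideal.mem_map_of_mem (Algebra.TensorProduct.map (IsScalarTower.toAlgHom K P L)
        (IsScalarTower.toAlgHom K P S)) this
      simpa using this
    obtain ⟨⟨p, t⟩, hst⟩ := IsLocalization.surj M s
    obtain ⟨w, hw⟩ := (IsLocalization.map_units S t).exists_right_inv
    dsimp at hst
    have h1 : (1 : L) ⊗ₜ[K] algebraMap P S t * (1 ⊗ₜ[K] s - algebraMap S L s ⊗ₜ 1) ∈ J := by
      have h2 : (1 : L) ⊗ₜ[K] algebraMap P S t * (1 ⊗ₜ[K] s - algebraMap S L s ⊗ₜ 1) =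
          ((1 : L) ⊗ₜ[K] algebraMap P S p - algebraMap P L p ⊗ₜ 1) -
          algebraMap S L s ⊗ₜ 1 * ((1 : L) ⊗ₜ[K] algebraMap P S t - algebraMap P L t ⊗ₜ 1) := by
        rw [IsScalarTower.algebraMap_apply P S L, IsScalarTower.algebraMap_apply P S L, ← hst]
        simp [mul_sub, mul_comm]
      rw [h2]
      exact J.sub_mem (hp _) (J.mul_mem_left _ (hp _))
    have h2 := J.mul_mem_left ((1 : L) ⊗ₜ[K] w) h1
    rwa [← mul_assoc, Algebra.TensorProduct.tmul_mul_tmul, mul_comm w, hw, one_mul,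
      ← Algebra.TensorProduct.one_def, one_mul] at h2

instance isMaximal_ker_evalTensor (K S L : Type*) [CommRing K] [CommRing S] [Field L] [Algebra K S]
    [Algebra K L] [Algebra S L] [IsScalarTower K S L] :
    (RingHom.ker (evalTensor K S L)).IsMaximal :=
  RingHom.ker_isMaximal_of_surjective _ fun c ↦ ⟨c ⊗ₜ 1, by simp⟩

theorem hasProjectiveDimensionLT_residueField_localization {K P S L : Type u} [CommRing K]
    [CommRing P] [CommRing S] [Field L] [Algebra K P] [Algebra K S] [Algebra P S]
    [IsScalarTower K P S] [Algebra K L] [Algebra S L] [IsScalarTower K S L] [Algebra P L]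
    [IsScalarTower K P L] [IsScalarTower P S L] (M : Submonoid P) [IsLocalization M S]
    (n : ℕ)
    (h : letI : Algebra (P ⊗[K] P) P :=
        (Algebra.TensorProduct.lmul' (S := P) K).toRingHom.toAlgebra
      HasProjectiveDimensionLT (ModuleCat.of (P ⊗[K] P) P) (n + 1))
    (B : Type u) [CommRing B] [IsLocalRing B] [Algebra (L ⊗[K] S) B]
    [IsLocalization.AtPrime B (RingHom.ker (evalTensor K S L))] [Module.Flat K P] :
    HasProjectiveDimensionLT (ModuleCat.of B (IsLocalRing.ResidueField B)) (n + 1) := by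
  let _ : Algebra (P ⊗[K] P) P := (Algebra.TensorProduct.lmul' (S := P) K).toRingHom.toAlgebra
  have hR : algebraMap (P ⊗[K] P) P = (Algebra.TensorProduct.lmul' (S := P) K).toRingHom := rfl
  have : IsScalarTower P (P ⊗[K] P) P := .of_algebraMap_eq fun p ↦ by simp [hR]
  let α : P ⊗[K] P →ₐ[P] L ⊗[K] P := Algebra.TensorProduct.map (Algebra.ofId P L) (AlgHom.id K P)
  let β : L ⊗[K] P →ₐ[L] L ⊗[K] S :=
    Algebra.TensorProduct.map (AlgHom.id L L) (IsScalarTower.toAlgHom K P S)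
  let _ : Algebra (P ⊗[K] P) (L ⊗[K] P) := α.toRingHom.toAlgebra
  have hα : algebraMap (P ⊗[K] P) (L ⊗[K] P) = α.toRingHom := rfl
  let _ : Algebra (L ⊗[K] P) B := ((algebraMap (L ⊗[K] S) B).comp β.toRingHom).toAlgebra
  have hβ : algebraMap (L ⊗[K] P) B = (algebraMap (L ⊗[K] S) B).comp β.toRingHom := rfl
  let _ : Algebra (P ⊗[K] P) B :=
    ((algebraMap (L ⊗[K] P) B).comp (algebraMap (P ⊗[K] P) (L ⊗[K] P))).toAlgebra
  have : IsScalarTower (P ⊗[K] P) (L ⊗[K] P) B := .of_algebraMap_eq' rfl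
  have : IsScalarTower P (P ⊗[K] P) (L ⊗[K] P) := .of_algebraMap_eq fun p ↦ by
    simp [hα, α]
  have : Algebra.IsPushout P L (P ⊗[K] P) (L ⊗[K] P) :=
    Algebra.IsPushout.tensorProduct_tensorProduct K (S := P) (A := P) (B := L) (by
      ext; simp [hα, α])
  have h1 := hasProjectiveDimensionLT_baseChange_of_isPushout (P := P) (L := L) (L ⊗[K] P) P n h
  have hβf : β.Flat := by
    refine RingHom.Flat.lTensor L (S := L) (f := IsScalarTower.toAlgHom K P S) ?_
    exact RingHom.flat_algebraMap_iff.mpr (IsLocalization.flat S M)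
  have : Module.Flat (L ⊗[K] P) B := by
    refine RingHom.flat_algebraMap_iff.mp (hβ ▸ RingHom.Flat.comp hβf ?_)
    exact RingHom.flat_algebraMap_iff.mpr
      (IsLocalization.flat B (RingHom.ker (evalTensor K S L)).primeCompl)
  have h2 := hasProjectiveDimensionLT_baseChange_of_flat B n _ h1
  have h3 := hasProjectiveDimensionLT_of_linearEquiv
    (AlgebraTensorModule.cancelBaseChange (P ⊗[K] P) (L ⊗[K] P) B B P) (n + 1) h2
  refine hasProjectiveDimensionLT_residueField_of_tensorProduct ?_ ?_ _ h3
  · intro p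
    exact ⟨p ⊗ₜ 1, by simp [hR]⟩
  · rw [← IsLocalization.AtPrime.map_eq_maximalIdeal (RingHom.ker (evalTensor K S L)) B,
      ← map_ker_lmul'_eq_ker_evalTensor M]
    have hc : algebraMap (P ⊗[K] P) B = (algebraMap (L ⊗[K] S) B).comp
        (Algebra.TensorProduct.map (IsScalarTower.toAlgHom K P L)
          (IsScalarTower.toAlgHom K P S)).toRingHom := by
      have : algebraMap (P ⊗[K] P) B =
        (algebraMap (L ⊗[K] S) B).comp (β.toRingHom.comp α.toRingHom) := rfl
      rw [this]
      congr 1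
      ext p <;> simp [α, β]
    rw [hc, ← Ideal.map_map]
    rfl

theorem one_tmul_mem_sq_of_tmul_D_eq_zero {K Q L : Type*} [CommRing K] [CommRing Q] [CommRing L]
    [Algebra K Q] [Algebra K L] [Algebra Q L] [IsScalarTower K Q L] {q : Q}
    (hq : algebraMap Q L q = 0) (h : (1 : L) ⊗ₜ[Q] KaehlerDifferential.D K Q q = 0) :
    (1 : L) ⊗ₜ[K] q ∈ RingHom.ker (evalTensor K Q L) ^ 2 := by
  set n := RingHom.ker (evalTensor K Q L) with hn
  have hL (c : L) (x : n.Cotangent) : c • x = (c ⊗ₜ[K] (1 : Q)) • x :=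
    algebra_compatible_smul (L ⊗[K] Q) c x
  have hmem (r : Q) : (1 : L) ⊗ₜ[K] r - algebraMap Q L r ⊗ₜ 1 ∈ n := by simp [hn, RingHom.mem_ker]
  have hzero {a : L ⊗[K] Q} (ha : a ∈ n) (x : n.Cotangent) : a • x = 0 := by
    obtain ⟨x, rfl⟩ := n.toCotangent_surjective x
    rw [← map_smul, Ideal.toCotangent_eq_zero, pow_two]
    exact Ideal.mul_mem_mul ha x.2
  have hQL (r : Q) (x : n.Cotangent) : r • x = algebraMap Q L r • x :=
    (algebraMap_smul L r x).symm
  have hQ (r : Q) (x : n.Cotangent) : r • x = ((1 : L) ⊗ₜ[K] r) • x := by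
    rw [hQL, hL, eq_comm, ← sub_eq_zero, ← sub_smul]
    exact hzero (hmem r) x
  let D : Derivation K Q n.Cotangent := Derivation.mk'
    { toFun r := n.toCotangent ⟨_, hmem r⟩
      map_add' r s := by
        rw [← map_add]
        congr 1
        ext
        simp only [tmul_add, map_add, add_tmul, Submodule.coe_add]
        ring
      map_smul' c r := by
        rw [RingHom.id_apply, algebra_compatible_smul (L ⊗[K] Q) c (n.toCotangent _), ← map_smul]
        congr 1
        ext
        simp only [algebraMap_smul, Algebra.smul_def c r, map_mul, ← IsScalarTower.algebraMap_apply]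
        simp [← Algebra.smul_def, smul_sub, smul_tmul'] }
    (fun r s ↦ by
      change n.toCotangent ⟨_, hmem (r * s)⟩ =
        r • n.toCotangent ⟨_, hmem s⟩ + s • n.toCotangent ⟨_, hmem r⟩
      rw [hQ, hQL s, hL, ← map_smul, ← map_smul, ← map_add]
      congr 1
      ext
      simp only [Submodule.coe_add, Submodule.coe_smul, smul_eq_mul, mul_sub, map_mul,
        Algebra.TensorProduct.tmul_mul_tmul, one_mul, mul_one, mul_comm (algebraMap Q L s)]
      abel)
  have hD (r : Q) : D r = n.toCotangent ⟨_, hmem r⟩ := rfl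
  have h2 := congr(LinearMap.liftBaseChange L D.liftKaehlerDifferential $h)
  rw [LinearMap.liftBaseChange_tmul, one_smul, Derivation.liftKaehlerDifferential_comp_D, hD,
    map_zero, Ideal.toCotangent_eq_zero] at h2
  simpa [hq] using h2

theorem one_tmul_eq_zero_of_mem_mul_ker {K Q S L : Type*} [CommRing K] [CommRing Q] [CommRing S]
    [CommRing L] [Algebra K Q] [Algebra K S] [Algebra K L] [Algebra Q S] [IsScalarTower K Q S]
    [Algebra Q L] [IsScalarTower K Q L] [Module.Flat K S]
    (hs : Function.Surjective (algebraMap Q S)) (i : RingHom.ker (algebraMap Q S))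
    (h : (1 : L) ⊗ₜ[K] (i : Q) ∈ RingHom.ker (evalTensor K Q L) * RingHom.ker
      (Algebra.TensorProduct.map (AlgHom.id L L) (IsScalarTower.toAlgHom K Q S))) :
    (1 : L) ⊗ₜ[Q] i = 0 := by
  let I := RingHom.ker (algebraMap Q S)
  let ι : I →ₗ[K] Q := (Submodule.subtype I).restrictScalars K
  let φ : Q →ₗ[K] S := (IsScalarTower.toAlgHom K Q S).toLinearMap
  have hex : Function.Exact ι φ := fun q ↦ ⟨fun hq ↦ ⟨⟨q, hq⟩, rfl⟩, fun ⟨x, hx⟩ ↦ hx ▸ x.2⟩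
  have hinj : Function.Injective (ι.lTensor L) :=
    LinearMap.lTensor_injective_of_exact_of_flat φ hs ι Subtype.val_injective hex L
  let j : L ⊗[K] I →ₗ[K] L ⊗[K] Q := ι.lTensor L
  let g : L ⊗[K] I →ₗ[L] L ⊗[Q] I := mapOfCompatibleSMul Q K L L I
  have hj (a) : a ∈ RingHom.ker
      (Algebra.TensorProduct.map (AlgHom.id L L) (IsScalarTower.toAlgHom K Q S)) →
      ∃ y, j y = a := fun ha ↦ (lTensor_exact L hex hs a).mp ha
  have claim (p : L ⊗[K] Q) (y : L ⊗[K] I) :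
      ∃ y', j y' = p * j y ∧ g y' = evalTensor K Q L p • g y := by
    induction p with
    | zero => exact ⟨0, by simp⟩
    | add p₁ p₂ h₁ h₂ =>
      obtain ⟨y₁, h₁, h₁'⟩ := h₁
      obtain ⟨y₂, h₂, h₂'⟩ := h₂
      exact ⟨y₁ + y₂, by simp [add_mul, h₁, h₂], by simp [add_smul, h₁', h₂']⟩
    | tmul c q =>
      induction y with
      | zero => exact ⟨0, by simp⟩
      | add p₁ p₂ h₁ h₂ =>
        obtain ⟨y₁, h₁, h₁'⟩ := h₁
        obtain ⟨y₂, h₂, h₂'⟩ := h₂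
        exact ⟨y₁ + y₂, by simp [mul_add, h₁, h₂], by simp [h₁', h₂']⟩
      | tmul d x =>
        refine ⟨(c * d) ⊗ₜ (q • x), by simp [j, ι], ?_⟩
        simp only [g, mapOfCompatibleSMul_tmul, evalTensor_tmul, smul_tmul', smul_eq_mul,
          ← smul_tmul, Algebra.smul_def]
        congr 1
        ring
  have key (w) (hw : w ∈ RingHom.ker (evalTensor K Q L) * RingHom.ker
      (Algebra.TensorProduct.map (AlgHom.id L L) (IsScalarTower.toAlgHom K Q S))) :
      ∃ y, j y = w ∧ g y = 0 := by
    induction hw using Submodule.mul_induction_on' with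
    | mem_mul_mem p hp a ha =>
      obtain ⟨y, rfl⟩ := hj a ha
      obtain ⟨y', h1, h2⟩ := claim p y
      exact ⟨y', h1, by rw [h2, hp, zero_smul]⟩
    | add x _ y _ h₁ h₂ =>
      obtain ⟨y₁, h₁, h₁'⟩ := h₁
      obtain ⟨y₂, h₂, h₂'⟩ := h₂
      exact ⟨y₁ + y₂, by simp [h₁, h₂], by simp [h₁', h₂']⟩
  obtain ⟨y, hy, hy'⟩ := key _ h
  have : y = 1 ⊗ₜ i := hinj (hy.trans (by simp [ι]))
  rw [← hy', this, mapOfCompatibleSMul_tmul]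

section

open IsLocalRing

theorem comap_ker_evalTensor (K Q S L : Type*) [CommRing K] [CommRing Q]
    [CommRing S] [CommRing L] [Algebra K Q] [Algebra K S] [Algebra K L] [Algebra Q S]
    [IsScalarTower K Q S] [Algebra Q L] [IsScalarTower K Q L] [Algebra S L] [IsScalarTower K S L]
    [IsScalarTower Q S L] :
    (RingHom.ker (evalTensor K S L)).comap (Algebra.TensorProduct.map (AlgHom.id L L)
      (IsScalarTower.toAlgHom K Q S)).toRingHom = RingHom.ker (evalTensor K Q L) := by
  have h : (evalTensor K S L).comp
      (Algebra.TensorProduct.map (AlgHom.id L L) (IsScalarTower.toAlgHom K Q S)) =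
      evalTensor K Q L := by
    ext q
    simp [← IsScalarTower.algebraMap_apply]
  rw [← h]
  rfl

theorem mem_mul_ker_of_mul_mem_mul_ker {A T B : Type*} [CommRing A] [CommRing T] [CommRing B]
    [Algebra T B] (φ : A →+* T) (hφ : Function.Surjective φ) (p : Ideal T) [p.IsPrime]
    [IsLocalization.AtPrime B p] [(p.comap φ).IsMaximal] {a : A} (ha : φ a = 0) {u : A}
    (hu : u ∉ p.comap φ)
    (h : u * a ∈ p.comap φ * RingHom.ker ((algebraMap T B).comp φ)) :
    a ∈ p.comap φ * RingHom.ker φ := by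
  set n := p.comap φ with hn
  have key (w) (hw : w ∈ n * RingHom.ker ((algebraMap T B).comp φ)) :
      ∃ v ∉ n, v * w ∈ n * RingHom.ker φ := by
    induction hw using Submodule.mul_induction_on' with
    | mem_mul_mem c hc k hk =>
      obtain ⟨⟨s, hs⟩, hsk⟩ := (IsLocalization.map_eq_zero_iff p.primeCompl B (φ k)).mp hk
      obtain ⟨v, rfl⟩ := hφ s
      refine ⟨v, hs, ?_⟩
      rw [mul_left_comm]
      exact Ideal.mul_mem_mul hc (by simpa [RingHom.mem_ker] using hsk)
    | add x _ y _ hx hy =>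
      obtain ⟨v, hv, hx⟩ := hx
      obtain ⟨w, hw, hy⟩ := hy
      refine ⟨v * w, fun h ↦ ((inferInstance : n.IsPrime).mem_or_mem h).elim hv hw, ?_⟩
      have : v * w * (x + y) = w * (v * x) + v * (w * y) := by ring
      rw [this]
      exact add_mem (Ideal.mul_mem_left _ _ hx) (Ideal.mul_mem_left _ _ hy)
  obtain ⟨v, hv, hva⟩ := key _ h
  have hvu : v * u ∉ n := fun h ↦ ((inferInstance : n.IsPrime).mem_or_mem h).elim hv hu
  obtain ⟨y, m, hm, hy⟩ := Ideal.IsMaximal.exists_inv ‹n.IsMaximal› hvu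
  have : a = y * (v * (u * a)) + m * a := by linear_combination -a * hy
  rw [this]
  exact add_mem (Ideal.mul_mem_left _ _ hva) (Ideal.mul_mem_mul hm ha)

theorem formallySmooth_of_hasProjectiveDimensionLT {K Q S : Type u} [CommRing K] [CommRing Q]
    [CommRing S] [IsLocalRing S] [Algebra K Q] [Algebra K S] [Algebra Q S] [IsScalarTower K Q S]
    [Algebra.FormallySmooth K Q] [Module.Free Q Ω[Q⁄K]] [Module.Finite Q Ω[Q⁄K]]
    [Algebra.EssFiniteType K Q] [Module.Flat K S]
    (hs : Function.Surjective (algebraMap Q S)) (hI : (RingHom.ker (algebraMap Q S)).FG)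
    (n : ℕ) (B : Type u) [CommRing B] [IsLocalRing B] [Algebra (ResidueField S ⊗[K] S) B]
    [IsLocalization.AtPrime B (RingHom.ker (evalTensor K S (ResidueField S)))]
    (h : HasProjectiveDimensionLT (ModuleCat.of B (ResidueField B)) (n + 1)) :
    Algebra.FormallySmooth K S := by
  rw [Algebra.FormallySmooth.iff_injective_cotangentComplexBaseChange_residueField (P := Q) hs hI,
    injective_iff_map_eq_zero]
  let L := ResidueField S
  let φ := (Algebra.TensorProduct.map (AlgHom.id L L) (IsScalarTower.toAlgHom K Q S))
  have hφ : Function.Surjective φ :=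
    Algebra.TensorProduct.map_surjective _ _ Function.surjective_id hs
  have hQL : Function.Surjective (algebraMap Q L) := by
    rw [IsScalarTower.algebraMap_eq Q S L]
    exact residue_surjective.comp hs
  let f : L ⊗[K] Q →+* B := (algebraMap (L ⊗[K] S) B).comp φ.toRingHom
  have hcomap : (RingHom.ker (evalTensor K S L)).comap φ.toRingHom =
      RingHom.ker (evalTensor K Q L) := comap_ker_evalTensor K Q S L
  have hB : (maximalIdeal B).comap (algebraMap (L ⊗[K] S) B) = RingHom.ker (evalTensor K S L) :=
    IsLocalization.AtPrime.under_maximalIdeal B (RingHom.ker (evalTensor K S L))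
  have hf : (maximalIdeal B).comap f = RingHom.ker (evalTensor K Q L) := by
    rw [← hcomap, ← hB, Ideal.comap_comap]
  have : IsNoetherianRing (L ⊗[K] Q) := Algebra.EssFiniteType.isNoetherianRing L _
  have : IsNoetherianRing (L ⊗[K] S) := isNoetherianRing_of_surjective _ _ φ.toRingHom hφ
  have : IsNoetherianRing B := IsLocalization.isNoetherianRing
    (RingHom.ker (evalTensor K S L)).primeCompl B inferInstance
  intro z hz
  obtain ⟨i, rfl⟩ : ∃ i : RingHom.ker (algebraMap Q S), z = 1 ⊗ₜ i := by
    clear hz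
    induction z with
    | zero => exact ⟨0, by simp⟩
    | add x y hx hy =>
      obtain ⟨i, rfl⟩ := hx
      obtain ⟨i', rfl⟩ := hy
      exact ⟨i + i', by rw [tmul_add]⟩
    | tmul c i =>
      obtain ⟨q, rfl⟩ := hQL c
      exact ⟨q • i, by rw [Algebra.algebraMap_eq_smul_one, smul_tmul]⟩
  rw [KaehlerDifferential.cotangentComplexBaseChange_tmul, one_smul,
    KaehlerDifferential.kerToTensor_apply] at hz
  have hi : algebraMap Q L i = 0 := by
    rw [IsScalarTower.algebraMap_apply Q S L, i.2, map_zero]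
  have hsq := one_tmul_mem_sq_of_tmul_D_eq_zero hi hz
  have hφi : φ (1 ⊗ₜ i) = 0 := by
    have := i.2
    rw [RingHom.mem_ker] at this
    simp [φ, this]
  obtain ⟨u, hu, hua⟩ := exists_mul_mem_mul_ker B f (fun b ↦ by
      obtain ⟨⟨t, s⟩, hst⟩ :=
        IsLocalization.surj (RingHom.ker (evalTensor K S L)).primeCompl b
      obtain ⟨a, rfl⟩ := hφ t
      obtain ⟨u, hu⟩ := hφ s
      refine ⟨a, u, ?_, ?_⟩
      · rw [hf, ← hcomap]
        exact fun h ↦ s.2 (hu ▸ h)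
      · rw [mul_comm]
        exact (congr(b * algebraMap _ B $hu)).trans hst) n h (a := 1 ⊗ₜ[K] (i : Q)) (by
      change algebraMap _ B (φ (1 ⊗ₜ i)) = 0; rw [hφi, map_zero]) (by rwa [hf])
  have : ((RingHom.ker (evalTensor K S L)).comap φ.toRingHom).IsMaximal := by
    rw [hcomap]; infer_instance
  refine one_tmul_eq_zero_of_mem_mul_ker (K := K) hs i ?_
  have := mem_mul_ker_of_mul_mem_mul_ker (B := B) φ.toRingHom hφ (RingHom.ker (evalTensor K S L))
    hφi (u := u) (by rwa [hcomap, ← hf]) (by rwa [hcomap, ← hf])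
  rwa [hcomap] at this

end

section

open IsLocalRing

theorem formallySmooth_of_essFiniteType {K S : Type u} [CommRing K] [IsNoetherianRing K]
    [CommRing S] [IsLocalRing S] [Algebra K S] [Algebra.EssFiniteType K S] [Module.Flat K S]
    (n : ℕ) (B : Type u) [CommRing B] [IsLocalRing B] [Algebra (ResidueField S ⊗[K] S) B]
    [IsLocalization.AtPrime B (RingHom.ker (evalTensor K S (ResidueField S)))]
    (h : HasProjectiveDimensionLT (ModuleCat.of B (ResidueField B)) (n + 1)) :
    Algebra.FormallySmooth K S := by
  let P := Algebra.EssFiniteType.subalgebra K S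
  let M := Algebra.EssFiniteType.submonoid K S
  obtain ⟨m, f₀, hf₀⟩ := Algebra.FiniteType.iff_quotient_mvPolynomial''.mp
    (inferInstance : Algebra.FiniteType K P)
  let M' := M.comap f₀
  let Q := Localization M'
  let f : Q →ₐ[K] S := IsLocalization.liftAlgHom (M := M')
      (f := (IsScalarTower.toAlgHom K P S).comp f₀) fun x ↦ by
    simpa using IsLocalization.map_units (M := M) S ⟨f₀ x.1, x.2⟩
  have hf : Function.Surjective f := by
    intro x
    obtain ⟨x, ⟨s, hs⟩, rfl⟩ := IsLocalization.exists_mk'_eq M x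
    obtain ⟨x, rfl⟩ := hf₀ x
    obtain ⟨s, rfl⟩ := hf₀ s
    refine ⟨IsLocalization.mk' (M := M') _ x ⟨s, hs⟩, ?_⟩
    simp [f, IsLocalization.lift_mk', Units.mul_inv_eq_iff_eq_mul, IsUnit.liftRight]
    exact (IsLocalization.mk'_spec S (f₀ x) ⟨f₀ s, hs⟩).symm
  have : IsNoetherianRing Q := IsLocalization.isNoetherianRing M' Q inferInstance
  algebraize [f.toRingHom]
  have : IsScalarTower K Q S := .of_algebraMap_eq' f.comp_algebraMap.symm
  have : Algebra.FormallyEtale (MvPolynomial (Fin m) K) Q := .of_isLocalization M'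
  have : Algebra.FormallySmooth K Q := .comp _ (MvPolynomial (Fin m) K) _
  have : Module.Free Q Ω[Q⁄K] :=
    .of_equiv (KaehlerDifferential.tensorKaehlerEquivOfFormallyEtale K (MvPolynomial (Fin m) K) Q)
  exact formallySmooth_of_hasProjectiveDimensionLT (Q := Q) hf (IsNoetherian.noetherian _) n B h

theorem formallySmooth_of_localization_atPrime (K P : Type*) [CommRing K] [CommRing P]
    [Algebra K P] [Algebra.EssFiniteType K P]
    [Module.FinitePresentation P Ω[P⁄K]]
    (h : ∀ q : PrimeSpectrum P, Algebra.FormallySmooth K (Localization.AtPrime q.asIdeal)) :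
    Algebra.FormallySmooth K P := by
  have h1 : Algebra.smoothLocus K P = Set.univ := Set.eq_univ_of_forall h
  rw [Algebra.smoothLocus_eq_compl_support_inter] at h1
  have h2 := Set.univ_subset_iff.mp (h1 ▸ Set.inter_subset_left)
  have h3 := Set.univ_subset_iff.mp (h1 ▸ Set.inter_subset_right)
  rw [Set.compl_univ_iff, Module.support_eq_empty_iff] at h2
  rw [Module.freeLocus_eq_univ_iff] at h3
  exact (Algebra.formallySmooth_iff _ _).mpr ⟨h3, h2⟩

theorem formallySmooth_of_projectiveDimension_tensorProduct (K P : Type u) [CommRing K]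
    [CommRing P] [IsNoetherianRing K] [Algebra K P] [Module.Flat K P] [Algebra.EssFiniteType K P]
    (n : ℕ)
    (h : letI : Algebra (P ⊗[K] P) P :=
        (Algebra.TensorProduct.lmul' (S := P) K).toRingHom.toAlgebra
      HasProjectiveDimensionLT (ModuleCat.of (P ⊗[K] P) P) (n + 1)) :
    Algebra.FormallySmooth K P := by
  have : IsNoetherianRing P := Algebra.EssFiniteType.isNoetherianRing K P
  have : Module.FinitePresentation P Ω[P⁄K] := Module.finitePresentation_of_finite P _
  refine formallySmooth_of_localization_atPrime K P fun q ↦ ?_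
  let S := Localization.AtPrime q.asIdeal
  have : Module.Flat P S := IsLocalization.flat S q.asIdeal.primeCompl
  have : Module.Flat K S := .trans K P S
  let B := Localization.AtPrime (RingHom.ker (evalTensor K S (ResidueField S)))
  exact formallySmooth_of_essFiniteType n B
    (hasProjectiveDimensionLT_residueField_localization (P := P) (S := S) (L := ResidueField S)
      q.asIdeal.primeCompl n h B)

end

theorem stmt2 (K P : Type) [CommRing K] [CommRing P] [IsNoetherianRing K]
    [IsNoetherianRing P] [Algebra K P]
    (hflat : Module.Flat K P) (heft : Algebra.EssFiniteType K P)
    (hpd : letI : Algebra (P ⊗[K] P) P :=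
        (Algebra.TensorProduct.lmul' (S := P) K).toRingHom.toAlgebra
      ∃ n : ℕ, ProjDimLE (P ⊗[K] P) P n) :
    EssentiallySmooth K P := by
  obtain ⟨n, F, π, hF, h0, hπ⟩ := hpd
  exact ⟨heft, hflat, formallySmooth_of_projectiveDimension_tensorProduct K P n
    (letI : Algebra (P ⊗[K] P) P :=
      (Algebra.TensorProduct.lmul' (S := P) K).toRingHom.toAlgebra
    projDimLE_hasProjectiveDimensionLE F π hF h0 hπ)⟩
end

section
/- Let K → P be an essentially smooth homomorphism of commutative noetherian rings of relative dimension d, and Pᵉ = P ⊗_K P. Then Extⁿ_{Pᵉ}(P, Pᵉ) = 0 for all n ≠ d. -/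
/-!
STATEMENT 4: For `K → P` essentially smooth of relative dimension `d` between
commutative noetherian rings, `Extⁿ_{Pᵉ}(P, Pᵉ) = 0` for all `n ≠ d`, where
`Pᵉ = P ⊗[K] P` and `P` is a `Pᵉ`-module via the multiplication map.
-/

open CategoryTheory TensorProduct

/-- `K → P` has relative dimension `d`: the module of Kähler differentials is
finite projective of constant rank `d` at every prime. -/
def RelDim (K P : Type) [CommRing K] [CommRing P] [Algebra K P] (d : ℕ) : Prop :=
  Module.Finite P (Ω[P⁄K]) ∧ Module.Projective P (Ω[P⁄K]) ∧
    ∀ (p : Ideal P) (_ : p.IsPrime),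
      Module.rank (Localization.AtPrime p) (LocalizedModule p.primeCompl (Ω[P⁄K])) = d

universe u

section Ext

open Abelian

theorem subsingleton_ext_obj_of_subsingleton_abelianExt {R : Type u} [CommRing R]
    (M N : ModuleCat.{u} R) (n : ℕ) (h : Subsingleton (Abelian.Ext.{u} M N n)) :
    Subsingleton (((_root_.Ext R (ModuleCat.{u} R) n).obj (Opposite.op M)).obj N) := by
  let P := projectiveResolution M
  apply ModuleCat.subsingleton_of_isZero
  refine Limits.IsZero.of_iso ?_ (P.isoExt (R := R) n N)
  rw [← HomologicalComplex.exactAt_iff_isZero_homology]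
  rcases n with _ | n
  · rw [HomologicalComplex.exactAt_iff' _ 0 0 1 (by simp) (by simp)]
    rw [ShortComplex.moduleCat_exact_iff]
    intro x hx
    have hx' : P.complex.d 1 0 ≫ (show P.complex.X 0 ⟶ N from x) = 0 := hx
    have hMN : Subsingleton (M ⟶ N) := Ext.homEquiv₀.subsingleton_congr.mp h
    have : Epi (ShortComplex.mk _ _ P.complex_d_comp_π_f_zero).g :=
      inferInstanceAs (Epi (P.π.f 0))
    have h0 := P.exact₀.g_desc _ hx'
    rw [show P.exact₀.desc _ hx' = 0 from hMN.elim _ _, Limits.comp_zero] at h0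
    exact ⟨0, (map_zero _).trans h0⟩
  · rw [HomologicalComplex.exactAt_iff' _ n (n+1) (n+2) (by simp) (by simp)]
    rw [ShortComplex.moduleCat_exact_iff]
    intro x hx
    have hx' : P.complex.d (n+2) (n+1) ≫ (show P.complex.X (n+1) ⟶ N from x) = 0 := hx
    have h0 := Subsingleton.elim (P.extMk (show P.complex.X (n+1) ⟶ N from x) (n+2) rfl hx') 0
    rw [P.extMk_eq_zero_iff _ _ _ _ n rfl] at h0
    exact h0

theorem subsingleton_hom_of_localized {R : Type u} [CommRing R]
    (M N : ModuleCat.{u} R)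
    (h : ∀ m : Ideal R, [m.IsMaximal] →
      Subsingleton (M.localizedModule m.primeCompl ⟶ N.localizedModule m.primeCompl)) :
    Subsingleton (M ⟶ N) := by
  refine subsingleton_of_forall_eq 0 fun f ↦ ?_
  ext x
  refine Module.eq_of_localization_maximal (fun m _ ↦ N.localizedModule m.primeCompl)
    (fun m _ ↦ N.localizedModuleMkLinearMap m.primeCompl) _ _ fun m _ ↦ ?_
  have h0 : ModuleCat.localizedModuleMap m.primeCompl f = 0 := (h m).elim _ _
  have := congr($(h0) (M.localizedModuleMkLinearMap m.primeCompl x))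
  simpa using this

theorem exists_extension_of_localized {R : Type u} [CommRing R] {K F N : ModuleCat.{u} R}
    [Module.Finite R K] [Module.FinitePresentation R F] (i : K ⟶ F) (g : K ⟶ N)
    (h : ∀ m : Ideal R, [m.IsMaximal] → ∃ φ : F.localizedModule m.primeCompl ⟶
      N.localizedModule m.primeCompl,
      ModuleCat.localizedModuleMap m.primeCompl i ≫ φ =
        ModuleCat.localizedModuleMap m.primeCompl g) :
    ∃ φ : F ⟶ N, i ≫ φ = g := by
  let T : Ideal R :=
    { carrier := {a | ∃ φ : F ⟶ N, i ≫ φ = a • g}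
      add_mem' := by
        rintro a b ⟨φ, hφ⟩ ⟨ψ, hψ⟩
        exact ⟨φ + ψ, by rw [Preadditive.comp_add, hφ, hψ, add_smul]⟩
      zero_mem' := ⟨0, by simp⟩
      smul_mem' := by
        rintro a b ⟨φ, hφ⟩
        exact ⟨a • φ, by rw [Linear.comp_smul, hφ, smul_smul, smul_eq_mul]⟩ }
  suffices hT : T = ⊤ by
    obtain ⟨φ, hφ⟩ := (Ideal.eq_top_iff_one T).mp hT
    exact ⟨φ, by rw [hφ, one_smul]⟩
  by_contra hT
  obtain ⟨m, hm, hle⟩ := T.exists_le_maximal hT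
  obtain ⟨φ, hφ⟩ := h m
  obtain ⟨ψ, s, hψ⟩ := Module.FinitePresentation.exists_lift_of_isLocalizedModule m.primeCompl
    (N.localizedModuleMkLinearMap m.primeCompl)
    ((φ.hom.restrictScalars R).comp (F.localizedModuleMkLinearMap m.primeCompl))
  obtain ⟨t, ht⟩ := Module.Finite.exists_smul_of_comp_eq_of_isLocalizedModule m.primeCompl
    (N.localizedModuleMkLinearMap m.primeCompl) (ψ ∘ₗ i.hom) (s.1 • g.hom) (by
      ext x
      have h1 := congr($hψ (i.hom x))
      have h2 := congr($hφ (K.localizedModuleMkLinearMap m.primeCompl x))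
      simp at h1 h2 ⊢
      rw [h1, h2]
      rfl)
  refine (t * s).2 (hle ⟨t.1 • ModuleCat.ofHom ψ, ?_⟩)
  ext x
  exact congr($ht x).trans (mul_smul t.1 s.1 (g.hom x)).symm

theorem subsingleton_ext_of_localized {R : Type u} [CommRing R] [IsNoetherianRing R]
    (M N : ModuleCat.{u} R) [Module.Finite R M] (n : ℕ)
    (h : ∀ m : Ideal R, [m.IsMaximal] → Subsingleton (Abelian.Ext.{u}
      (M.localizedModule m.primeCompl) (N.localizedModule m.primeCompl) n)) :
    Subsingleton (Abelian.Ext.{u} M N n) := by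
  induction n generalizing M with
  | zero =>
    have := subsingleton_hom_of_localized M N fun m _ ↦
      Ext.homEquiv₀.subsingleton_congr.mp (h m)
    exact Ext.homEquiv₀.subsingleton_congr.mpr this
  | succ n ih =>
    obtain ⟨F, _, _, _, _, f, surjf⟩ := Module.exists_finite_presentation R M
    let S := f.shortComplexKer
    have hS : S.ShortExact := LinearMap.shortExact_shortComplexKer surjf
    have : Module.Finite R S.X₁ := inferInstanceAs (Module.Finite R (LinearMap.ker f))
    have : Module.Finite R S.X₂ := inferInstanceAs (Module.Finite R F)
    have : Module.FinitePresentation R S.X₂ := Module.finitePresentation_of_finite R _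
    have proj := ModuleCat.projective_of_categoryTheory_projective S.X₂
    let Sm (m : Ideal R) [m.IsMaximal] := S.map (ModuleCat.localizedModuleFunctor m.primeCompl)
    have hSm (m : Ideal R) [m.IsMaximal] : (Sm m).ShortExact :=
      hS.map_of_exact (ModuleCat.localizedModuleFunctor m.primeCompl)
    have projm (m : Ideal R) [m.IsMaximal] : Projective (Sm m).X₂ :=
      (ModuleCat.localizedModuleFunctor.{u} m.primeCompl).projective_obj_of_projective proj
    rcases n with _ | n
    · refine subsingleton_of_forall_eq 0 fun x ↦ ?_
      obtain ⟨x₁, rfl⟩ := Ext.contravariant_sequence_exact₃ hS N x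
        (Ext.eq_zero_of_projective _) (add_comm 1 0)
      obtain ⟨g, rfl⟩ := (Ext.mk₀_bijective _ _).2 x₁
      obtain ⟨φ, rfl⟩ := exists_extension_of_localized S.f g fun m _ ↦ by
        have := h m
        obtain ⟨x₂, hx₂⟩ := Ext.contravariant_sequence_exact₁ (hSm m)
          (N.localizedModule m.primeCompl)
          (Ext.mk₀ (ModuleCat.localizedModuleMap m.primeCompl g)) (add_comm 1 0)
          (this.elim _ _)
        obtain ⟨φ, rfl⟩ := (Ext.mk₀_bijective _ _).2 x₂
        rw [Ext.mk₀_comp_mk₀] at hx₂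
        exact ⟨φ, (Ext.mk₀_bijective _ _).1 hx₂⟩
      rw [← Ext.mk₀_comp_mk₀, ShortComplex.ShortExact.extClass_comp_assoc]
    · have : Subsingleton (Abelian.Ext.{u} S.X₁ N (n + 1)) := by
        refine ih S.X₁ fun m _ ↦ ?_
        have := h m
        refine subsingleton_of_forall_eq 0 fun x ↦ ?_
        obtain ⟨x₂, rfl⟩ := Ext.contravariant_sequence_exact₁ (hSm m) _ x (add_comm 1 (n + 1))
          (this.elim _ _)
        rw [Ext.eq_zero_of_projective x₂, Ext.comp_zero]
        rfl
      refine subsingleton_of_forall_eq 0 fun x ↦ ?_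
      obtain ⟨x₁, rfl⟩ := Ext.contravariant_sequence_exact₃ hS N x
        (Ext.eq_zero_of_projective _) (add_comm 1 (n + 1))
      rw [Subsingleton.elim x₁ 0, Ext.comp_zero]

end Ext

section ExtRegular

open Abelian IsLocalRing RingTheory.Sequence

theorem subsingleton_ext_of_isRegular {R : Type u} [CommRing R] [IsNoetherianRing R]
    [IsLocalRing R] (rs : List R) (hrs : IsRegular R rs) (M N : ModuleCat.{u} R)
    (eM : M ≃ₗ[R] R ⧸ Ideal.ofList rs) (eN : N ≃ₗ[R] R) (n : ℕ) (hn : n ≠ rs.length) :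
    Subsingleton (Ext.{u} M N n) := by
  have : Module.Finite R M := Module.Finite.equiv eM.symm
  have : Module.Finite R N := Module.Finite.equiv eN.symm
  have hN : IsRegular N rs := (eN.isRegular_congr rs).mpr hrs
  rcases lt_or_gt_of_ne hn with hlt | hgt
  · refine ModuleCat.subsingleton_ext_of_exists_isRegular (Ideal.ofList rs) M ?_ N
      hN.top_ne_smul.symm.lt_top rs (fun r hr => Ideal.subset_span hr) hN n hlt
    rw [eM.support_eq, Module.support_eq_zeroLocus, Ideal.annihilator_quotient]
  · have h := ModuleCat.projectiveDimension_quotient_eq_length.{u} rs hrs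
    rw [projectiveDimension_eq_of_iso
      ((Shrink.linearEquiv R (R ⧸ Ideal.ofList rs)).trans eM.symm).toModuleIso] at h
    have hle : HasProjectiveDimensionLE M rs.length := (projectiveDimension_le_iff _ _).mp h.le
    exact HasProjectiveDimensionLT.subsingleton M (rs.length + 1) n hgt N

end ExtRegular

section RegularSequence

open MvPolynomial

section Polynomial

variable {σ : Type*} {B : Type*} [CommRing B]

theorem aeval_sub_mem_idealOfVars {Y : σ → MvPolynomial σ B}
    (hY : ∀ i, Y i - X i ∈ idealOfVars σ B ^ 2) (F : MvPolynomial σ B) :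
    aeval Y F - F ∈ idealOfVars σ B := by
  have h : (Ideal.Quotient.mkₐ B (idealOfVars σ B)).comp (aeval Y) =
      Ideal.Quotient.mkₐ B (idealOfVars σ B) := by
    refine algHom_ext fun i => ?_
    rw [AlgHom.comp_apply, aeval_X]
    exact Ideal.Quotient.eq.mpr (Ideal.pow_le_self two_ne_zero (hY i))
  rw [← Ideal.Quotient.mk_eq_mk_iff_sub_mem]
  exact DFunLike.congr_fun h F

theorem aeval_sub_mem_idealOfVars_pow {Y : σ → MvPolynomial σ B}
    (hY : ∀ i, Y i - X i ∈ idealOfVars σ B ^ 2) (n : ℕ) {F : MvPolynomial σ B}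
    (hF : F ∈ idealOfVars σ B ^ n) :
    aeval Y F - F ∈ idealOfVars σ B ^ (n + 1) := by
  have hmul {u v : MvPolynomial σ B} : aeval Y (u * v) - u * v =
      (aeval Y u - u) * aeval Y v + u * (aeval Y v - v) := by
    rw [map_mul]; ring
  have h1 (u : MvPolynomial σ B) (hu : u ∈ idealOfVars σ B) :
      aeval Y u - u ∈ idealOfVars σ B ^ 2 := by
    induction hu using Submodule.span_induction with
    | mem u hu =>
      obtain ⟨i, rfl⟩ := hu
      simpa using hY i
    | zero => simp
    | add u v _ _ hu hv =>
      rw [map_add, add_sub_add_comm]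
      exact add_mem hu hv
    | smul a u hu' hu =>
      rw [smul_eq_mul, hmul, sq]
      have hv : aeval Y u ∈ idealOfVars σ B := by
        simpa using add_mem (aeval_sub_mem_idealOfVars hY u) hu'
      exact add_mem (Ideal.mul_mem_mul (aeval_sub_mem_idealOfVars hY a) hv)
        (Ideal.mul_mem_left _ _ (sq (idealOfVars σ B) ▸ hu))
  induction n generalizing F with
  | zero => simpa using aeval_sub_mem_idealOfVars hY F
  | succ n ih =>
    rw [pow_succ'] at hF
    induction hF using Submodule.mul_induction_on' with
    | mem_mul_mem u hu v hv =>
      rw [hmul]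
      have hv' : aeval Y v ∈ idealOfVars σ B ^ n := by
        simpa using add_mem (Ideal.pow_le_pow_right n.le_succ (ih hv)) hv
      refine add_mem ?_ ?_
      · rw [show n + 1 + 1 = 2 + n by ring, pow_add]
        exact Ideal.mul_mem_mul (h1 u hu) hv'
      · rw [pow_succ']
        exact Ideal.mul_mem_mul hu (ih hv)
    | add u _ v _ hu hv =>
      rw [map_add, add_sub_add_comm]
      exact add_mem hu hv

theorem mem_idealOfVars_pow_of_aeval_mem {Y : σ → MvPolynomial σ B}
    (hY : ∀ i, Y i - X i ∈ idealOfVars σ B ^ 2) (n : ℕ) {F : MvPolynomial σ B}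
    (hF : aeval Y F ∈ idealOfVars σ B ^ n) : F ∈ idealOfVars σ B ^ n := by
  suffices ∀ j ≤ n, F ∈ idealOfVars σ B ^ j from this n le_rfl
  intro j hj
  induction j with
  | zero => simp
  | succ j ih =>
    simpa using sub_mem (Ideal.pow_le_pow_right hj hF)
      (aeval_sub_mem_idealOfVars_pow hY j (ih (by lia)))

theorem mem_span_X_image_sup_of_mul_X_mem {s : Set σ} {k : σ} (hk : k ∉ s) (n : ℕ)
    {F : MvPolynomial σ B}
    (hF : F * X k ∈ Ideal.span (X '' s) ⊔ idealOfVars σ B ^ (n + 1)) :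
    F ∈ Ideal.span (X '' s) ⊔ idealOfVars σ B ^ n := by
  obtain ⟨G, hG, H, hH, hGH⟩ := Submodule.mem_sup.mp hF
  rw [F.as_sum]
  refine Ideal.sum_mem _ fun m hm => ?_
  by_cases hs : ∃ i ∈ s, m i ≠ 0
  · refine Ideal.mem_sup_left (mem_ideal_span_X_image.mpr fun m' hm' => ?_)
    obtain rfl := Finset.mem_singleton.mp (support_monomial_subset hm')
    exact hs
  · refine Ideal.mem_sup_right ?_
    rw [monomial_mem_pow_idealOfVars_iff _ _ (mem_support_iff.mp hm)]
    by_contra! hlt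
    have hc := congrArg (coeff (m + Finsupp.single k 1)) hGH
    rw [coeff_mul_X, coeff_add] at hc
    have hG0 : coeff (m + Finsupp.single k 1) G = 0 := by
      by_contra hne
      obtain ⟨i, hi, hmi⟩ := mem_ideal_span_X_image.mp hG _ (mem_support_iff.mpr hne)
      have hik : k ≠ i := fun h => hk (h ▸ hi)
      exact hs ⟨i, hi, by simpa [Finsupp.single_apply, hik] using hmi⟩
    have hH0 : coeff (m + Finsupp.single k 1) H = 0 := by
      refine (mem_pow_idealOfVars_iff' _ _).mp hH _ ?_
      simpa using hlt
    rw [hG0, hH0, zero_add] at hc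
    exact mem_support_iff.mp hm hc.symm

end Polynomial

section Krull

variable {R : Type*} [CommRing R] [IsNoetherianRing R] [IsLocalRing R]

theorem mem_of_forall_mem_sup_pow {J : Ideal R} (hJ : J ≠ ⊤) (I : Ideal R) {r : R}
    (h : ∀ n, r ∈ I ⊔ J ^ n) : r ∈ I := by
  rw [← Ideal.Quotient.eq_zero_iff_mem]
  have hbot := J.iInf_pow_smul_eq_bot_of_isLocalRing (M := R ⧸ I) hJ
  rw [← Submodule.mem_bot R, ← hbot, Submodule.mem_iInf]
  intro n
  obtain ⟨a, ha, b, hb, rfl⟩ := Submodule.mem_sup.mp (h n)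
  rw [map_add, Ideal.Quotient.eq_zero_iff_mem.mpr ha, zero_add]
  have := Submodule.smul_mem_smul hb (Submodule.mem_top (R := R) (x := (1 : R ⧸ I)))
  rwa [Algebra.smul_def, mul_one] at this

end Krull

section Regular

variable {B R : Type*} [CommRing B] [CommRing R] [Algebra B R] {d : ℕ} (x : Fin d → R)

theorem exists_sub_aeval_mem_pow
    (hB : ∀ r, ∃ b, r - algebraMap B R b ∈ Ideal.span (Set.range x)) (n : ℕ) (r : R) :
    ∃ F : MvPolynomial (Fin d) B, r - aeval x F ∈ Ideal.span (Set.range x) ^ n := by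
  induction n generalizing r with
  | zero => exact ⟨0, by simp⟩
  | succ n ih =>
    obtain ⟨b, hb⟩ := hB r
    obtain ⟨c, hc⟩ := (Ideal.mem_span_range_iff_exists_fun).mp hb
    choose F hF using ih
    refine ⟨C b + ∑ i, F (c i) * X i, ?_⟩
    have : r - aeval x (C b + ∑ i, F (c i) * X i) =
        ∑ i, (c i - aeval x (F (c i))) * x i := by
      simp only [sub_mul, Finset.sum_sub_distrib, hc, map_add, map_sum, map_mul, aeval_X,
        algHom_C]
      ring
    rw [this, pow_succ]
    exact Ideal.sum_mem _ fun i _ =>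
      Ideal.mul_mem_mul (hF _) (Ideal.subset_span (Set.mem_range_self i))

theorem exists_mem_span_X_image_sub_aeval_mem
    (hB : ∀ r, ∃ b, r - algebraMap B R b ∈ Ideal.span (Set.range x)) (s : Set (Fin d)) (n : ℕ)
    {a : R} (ha : a ∈ Ideal.span (x '' s)) :
    ∃ G ∈ Ideal.span ((X : Fin d → MvPolynomial (Fin d) B) '' s),
      a - aeval x G ∈ Ideal.span (Set.range x) ^ n := by
  induction ha using Submodule.span_induction with
  | mem a ha =>
    obtain ⟨i, hi, rfl⟩ := ha
    exact ⟨X i, Ideal.subset_span (Set.mem_image_of_mem _ hi), by simp⟩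
  | zero => exact ⟨0, zero_mem _, by simp⟩
  | add a a' _ _ h h' =>
    obtain ⟨G, hG, hGa⟩ := h
    obtain ⟨G', hG', hGa'⟩ := h'
    refine ⟨G + G', add_mem hG hG', ?_⟩
    rw [map_add, add_sub_add_comm]
    exact add_mem hGa hGa'
  | smul r a _ h =>
    obtain ⟨G, hG, hGa⟩ := h
    obtain ⟨F, hF⟩ := exists_sub_aeval_mem_pow x hB n r
    refine ⟨F * G, Ideal.mul_mem_left _ _ hG, ?_⟩
    have : r • a - aeval x (F * G) = (r - aeval x F) * a + aeval x F * (a - aeval x G) := by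
      rw [map_mul, smul_eq_mul]; ring
    rw [this]
    exact add_mem (Ideal.mul_mem_right _ _ hF) (Ideal.mul_mem_left _ _ hGa)

theorem mem_idealOfVars_pow_of_aeval_mem_span_pow {n : ℕ}
    (φ : R →ₐ[B] MvPolynomial (Fin d) B ⧸ idealOfVars (Fin d) B ^ n)
    (Y : Fin d → MvPolynomial (Fin d) B) (hY : ∀ i, Y i - X i ∈ idealOfVars (Fin d) B ^ 2)
    (hφ : ∀ i, φ (x i) = Ideal.Quotient.mk _ (Y i)) {F : MvPolynomial (Fin d) B}
    (hF : aeval x F ∈ Ideal.span (Set.range x) ^ n) : F ∈ idealOfVars (Fin d) B ^ n := by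
  refine mem_idealOfVars_pow_of_aeval_mem hY n ?_
  have hcomp : φ.comp (aeval x) = (Ideal.Quotient.mkₐ B _).comp (aeval Y) :=
    algHom_ext fun i => by simpa using hφ i
  have hmap : (Ideal.span (Set.range x) ^ n).map φ = ⊥ := by
    rw [Ideal.map_pow, eq_bot_iff]
    calc (Ideal.map φ (Ideal.span (Set.range x))) ^ n
        ≤ ((idealOfVars (Fin d) B).map (Ideal.Quotient.mk (idealOfVars (Fin d) B ^ n))) ^ n := by
          refine Ideal.pow_right_mono ?_ n
          rw [Ideal.map_le_iff_le_comap, Ideal.span_le]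
          rintro _ ⟨i, rfl⟩
          rw [SetLike.mem_coe, Ideal.mem_comap, hφ]
          refine Ideal.mem_map_of_mem _ ?_
          simpa using add_mem (Ideal.pow_le_self two_ne_zero (hY i))
            (Ideal.subset_span (Set.mem_range_self i))
      _ = ⊥ := by rw [← Ideal.map_pow, Ideal.map_quotient_self]
  have h0 : φ (aeval x F) ∈ (⊥ : Ideal _) := hmap ▸ Ideal.mem_map_of_mem φ hF
  have h1 := DFunLike.congr_fun hcomp F
  rw [AlgHom.comp_apply, Ideal.mem_bot.mp h0] at h1
  exact Ideal.Quotient.eq_zero_iff_mem.mp h1.symm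

theorem isRegular_ofFn_of_algHom [IsNoetherianRing R] [IsLocalRing R]
    (hx : ∀ i, x i ∈ IsLocalRing.maximalIdeal R)
    (hB : ∀ r, ∃ b, r - algebraMap B R b ∈ Ideal.span (Set.range x))
    (hφ : ∀ n, ∃ (φ : R →ₐ[B] MvPolynomial (Fin d) B ⧸ idealOfVars (Fin d) B ^ n)
      (Y : Fin d → MvPolynomial (Fin d) B), (∀ i, Y i - X i ∈ idealOfVars (Fin d) B ^ 2) ∧
      ∀ i, φ (x i) = Ideal.Quotient.mk _ (Y i)) :
    RingTheory.Sequence.IsRegular R (List.ofFn x) := by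
  have hlist (l : List R) : (Ideal.ofList l • ⊤ : Submodule R R) = Ideal.ofList l := by
    rw [smul_eq_mul, Ideal.mul_top]
  set J := Ideal.span (Set.range x) with hJdef
  have hJ : J ≠ ⊤ := fun h => (IsLocalRing.maximalIdeal.isMaximal R).ne_top <| by
    rw [eq_top_iff, ← h, Ideal.span_le]
    rintro _ ⟨i, rfl⟩
    exact hx i
  have hkey (k : Fin d) (s : Set (Fin d)) (hk : k ∉ s) (r : R)
      (hr : r * x k ∈ Ideal.span (x '' s)) : r ∈ Ideal.span (x '' s) := by
    refine mem_of_forall_mem_sup_pow hJ _ fun n => ?_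
    obtain ⟨φ, Y, hY, hφ⟩ := hφ (n + 1)
    have hmap (m : ℕ) : (Ideal.span (X '' s) ⊔ idealOfVars (Fin d) B ^ m).map (aeval x) =
        Ideal.span (x '' s) ⊔ J ^ m := by
      rw [Ideal.map_sup, Ideal.map_pow, Ideal.map_span, Ideal.map_span, ← Set.range_comp,
        Set.image_image]
      simp only [aeval_X, Function.comp_def, hJdef]
    obtain ⟨F, hF⟩ := exists_sub_aeval_mem_pow x hB n r
    have hFX : F * X k ∈ Ideal.span (X '' s) ⊔ idealOfVars (Fin d) B ^ (n + 1) := by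
      have hmem : aeval x (F * X k) ∈ Ideal.span (x '' s) ⊔ J ^ (n + 1) := by
        rw [map_mul, aeval_X, ← sub_sub_cancel r (aeval x F), sub_mul]
        refine sub_mem (Ideal.mem_sup_left hr) (Ideal.mem_sup_right ?_)
        rw [pow_succ]
        exact Ideal.mul_mem_mul hF (Ideal.subset_span (Set.mem_range_self k))
      obtain ⟨a, ha, b, hb, hab⟩ := Submodule.mem_sup.mp hmem
      obtain ⟨G, hG, hGa⟩ := exists_mem_span_X_image_sub_aeval_mem x hB s (n + 1) ha
      have hFG : F * X k - G ∈ idealOfVars (Fin d) B ^ (n + 1) := by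
        refine mem_idealOfVars_pow_of_aeval_mem_span_pow x φ Y hY hφ ?_
        rw [map_sub, ← hab, add_sub_right_comm]
        exact add_mem hGa hb
      rw [← sub_add_cancel (F * X k) G]
      exact add_mem (Ideal.mem_sup_right hFG) (Ideal.mem_sup_left hG)
    have := Ideal.mem_map_of_mem (aeval x) (mem_span_X_image_sup_of_mul_X_mem hk n hFX)
    rw [hmap] at this
    rw [← sub_add_cancel r (aeval x F)]
    exact add_mem (Ideal.mem_sup_right hF) this
  refine ⟨⟨fun i hi => ?_⟩, ?_⟩
  · rw [List.length_ofFn] at hi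
    have hof : Ideal.ofList ((List.ofFn x).take i) = Ideal.span (x '' {j | j.1 < i}) := by
      rw [Ideal.ofList]
      congr 1
      ext r
      simp only [List.mem_take_iff_getElem, Set.mem_ofPred_eq, Set.mem_image]
      constructor
      · rintro ⟨j, hj, rfl⟩
        simp only [List.length_ofFn, lt_min_iff] at hj
        exact ⟨⟨j, hj.2⟩, hj.1, by simp⟩
      · rintro ⟨j, hj, rfl⟩
        exact ⟨j, by simp [hj], by simp⟩
    rw [List.getElem_ofFn, hlist, hof, isSMulRegular_iff_right_eq_zero_of_smul]
    intro r hr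
    obtain ⟨r, rfl⟩ := Ideal.Quotient.mk_surjective r
    rw [Ideal.Quotient.eq_zero_iff_mem]
    refine hkey ⟨i, hi⟩ _ (by simp) r ?_
    rw [mul_comm, ← Ideal.Quotient.eq_zero_iff_mem]
    exact hr
  · rw [hlist, Ideal.ofList]
    simp only [List.mem_ofFn]
    exact hJ.symm

end Regular

end RegularSequence

section Lifting

open MvPolynomial

variable {P A B R : Type*} [CommRing P] [CommRing A] [Algebra P A] [CommRing B] [Algebra P B]
  {d : ℕ} (π : A →ₐ[P] P)

theorem exists_algHom_quotient_sq (D : A →ₗ[P] Fin d → B)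
    (hD : ∀ a b, D (a * b) = π a • D b + π b • D a) :
    ∃ δ : A →ₐ[P] MvPolynomial (Fin d) B ⧸ idealOfVars (Fin d) B ^ 2,
      ∀ a, δ a = Ideal.Quotient.mk _ (C (algebraMap P B (π a)) + ∑ i, C (D a i) * X i) := by
  have hD1 : D 1 = 0 := by simpa using hD 1 1
  have hmem (a : A) : ∑ i, C (D a i) * X i ∈ idealOfVars (Fin d) B :=
    Ideal.sum_mem _ fun i _ => Ideal.mul_mem_left _ _ (Ideal.subset_span (Set.mem_range_self i))
  have hsmul (c : P) (v : Fin d → B) : ∑ i, C ((c • v) i) * X i =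
      C (algebraMap P B c) * ∑ i, C (v i) * (X i : MvPolynomial (Fin d) B) := by
    rw [Finset.mul_sum]
    exact Finset.sum_congr rfl fun i _ => by
      rw [Pi.smul_apply, Algebra.smul_def, map_mul, mul_assoc]
  refine ⟨AlgHom.ofLinearMap
    { toFun a := Ideal.Quotient.mk _ (C (algebraMap P B (π a)) + ∑ i, C (D a i) * X i)
      map_add' a b := ?_
      map_smul' c a := ?_ } ?_ ?_, fun a => rfl⟩
  · rw [← map_add]
    congr 1
    simp only [map_add, Pi.add_apply, add_mul, Finset.sum_add_distrib]
    ring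
  · change _ = Ideal.Quotient.mk _ (c • _)
    rw [map_smul π, map_smul D, hsmul, smul_eq_mul, map_mul (algebraMap P B), C_mul,
      ← mul_add, Algebra.smul_def]
    rfl
  · simp [hD1]
  · intro a b
    change Ideal.Quotient.mk _ _ = Ideal.Quotient.mk _ _ * Ideal.Quotient.mk _ _
    rw [← map_mul, Ideal.Quotient.mk_eq_mk_iff_sub_mem]
    have := neg_mem (Ideal.mul_mem_mul (hmem a) (hmem b))
    rw [← sq] at this
    convert this using 1
    simp only [hD, Pi.add_apply, map_add, add_mul, Finset.sum_add_distrib]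
    rw [hsmul, hsmul]
    simp only [map_mul]
    ring

theorem exists_algHom_of_formallySmooth [Algebra.FormallySmooth P A] [CommRing R]
    (p : Ideal P) [p.IsPrime] [IsLocalization.AtPrime B p] [Algebra A R]
    [IsLocalization.AtPrime R (p.comap π)] [Algebra P R] [IsScalarTower P A R]
    [Algebra B R] [IsScalarTower P B R] (D : A →ₗ[P] Fin d → B)
    (hD : ∀ a b, D (a * b) = π a • D b + π b • D a) (x : Fin d → A) (hx : ∀ i, π (x i) = 0)
    (hDx : ∀ i, D (x i) = Pi.single i 1) (n : ℕ) :
    ∃ (φ : R →ₐ[B] MvPolynomial (Fin d) B ⧸ idealOfVars (Fin d) B ^ n)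
      (Y : Fin d → MvPolynomial (Fin d) B), (∀ i, Y i - X i ∈ idealOfVars (Fin d) B ^ 2) ∧
      ∀ i, φ (algebraMap A R (x i)) = Ideal.Quotient.mk _ (Y i) := by
  obtain ⟨δ, hδ⟩ := exists_algHom_quotient_sq π D hD
  let I := idealOfVars (Fin d) B
  let g : (MvPolynomial (Fin d) B ⧸ I ^ (n + 2)) →ₐ[P] MvPolynomial (Fin d) B ⧸ I ^ 2 :=
    Ideal.Quotient.factorₐ P (Ideal.pow_le_pow_right (Nat.le_add_left 2 n))
  have hg : Function.Surjective g :=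
    Ideal.Quotient.factor_surjective (Ideal.pow_le_pow_right (Nat.le_add_left 2 n))
  have hgn : IsNilpotent (RingHom.ker g.toRingHom) := by
    refine ⟨n + 2, ?_⟩
    rw [Ideal.zero_eq_bot, eq_bot_iff, ← Ideal.map_quotient_self (I ^ (n + 2)), Ideal.map_pow]
    refine Ideal.pow_right_mono (fun y hy => ?_) _
    obtain ⟨F, rfl⟩ := Ideal.Quotient.mk_surjective y
    exact Ideal.mem_map_of_mem _ (Ideal.pow_le_self two_ne_zero
      (Ideal.Quotient.eq_zero_iff_mem.mp hy))
  let f := Algebra.FormallySmooth.liftOfSurjective δ g hg hgn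
  have hf (a : A) : g (f a) = δ a := Algebra.FormallySmooth.liftOfSurjective_apply δ g hg hgn a
  choose Y hY using fun a => Ideal.Quotient.mk_surjective (f a)
  have hYδ (a : A) : Y a - (C (algebraMap P B (π a)) + ∑ i, C (D a i) * X i) ∈ I ^ 2 := by
    rw [← Ideal.Quotient.mk_eq_mk_iff_sub_mem, ← hδ, ← hf, ← hY]
    rfl
  let f' : A →ₐ[P] MvPolynomial (Fin d) B ⧸ I ^ n :=
    (Ideal.Quotient.factorₐ P (Ideal.pow_le_pow_right (Nat.le_add_right n 2))).comp f
  have hf' (a : A) : f' a = Ideal.Quotient.mk _ (Y a) := by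
    change Ideal.Quotient.factorₐ P (Ideal.pow_le_pow_right (Nat.le_add_right n 2)) (f a) = _
    rw [← hY]
    rfl
  have hunit (s : (p.comap π).primeCompl) : IsUnit (f' s) := by
    have hs : IsUnit (algebraMap P B (π s)) :=
      IsLocalization.map_units B (⟨π s, s.2⟩ : p.primeCompl)
    have hnil : IsNilpotent (Ideal.Quotient.mk (I ^ n) (Y s - C (algebraMap P B (π s)))) := by
      refine ⟨n, ?_⟩
      rw [← map_pow, Ideal.Quotient.eq_zero_iff_mem]
      refine Ideal.pow_mem_pow ?_ n
      have := add_mem (Ideal.pow_le_self two_ne_zero (hYδ s))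
        (Ideal.sum_mem _ fun i (_ : i ∈ Finset.univ) =>
          Ideal.mul_mem_left _ (C (D s i)) (Ideal.subset_span (Set.mem_range_self i)))
      rwa [sub_add_eq_sub_sub, sub_add_cancel] at this
    rw [hf', ← sub_add_cancel (Y s) (C (algebraMap P B (π s))), map_add]
    exact hnil.isUnit_add_right_of_commute ((hs.map C).map _) (Commute.all _ _)
  let φ : R →+* MvPolynomial (Fin d) B ⧸ I ^ n :=
    IsLocalization.lift (M := (p.comap π).primeCompl) (g := f'.toRingHom) hunit
  have hφ (a : A) : φ (algebraMap A R a) = f' a := IsLocalization.lift_eq _ a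
  have hcomm : φ.comp (algebraMap B R) = algebraMap B _ := by
    refine IsLocalization.ringHom_ext p.primeCompl ?_
    ext c
    simp only [RingHom.comp_apply]
    rw [← IsScalarTower.algebraMap_apply, IsScalarTower.algebraMap_apply P A R, hφ,
      ← IsScalarTower.algebraMap_apply]
    exact f'.commutes c
  refine ⟨⟨φ, fun b => RingHom.congr_fun hcomm b⟩, fun i => Y (x i), fun i => ?_, fun i => ?_⟩
  · have := hYδ (x i)
    rw [hx, hDx, map_zero, C_0, zero_add] at this
    simpa [Pi.single_apply] using this
  · exact (hφ _).trans (hf' _)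

end Lifting

section Generators

variable {P A B R Ω Ω' : Type*} [CommRing P] [CommRing A] [Algebra P A] [CommRing B] [Algebra P B]
  [CommRing R] [Algebra A R] {d : ℕ} (π : A →ₐ[P] P) (p : Ideal P) [p.IsPrime]
  [IsLocalization.AtPrime B p] [IsLocalization.AtPrime R (p.comap π)]
  [AddCommGroup Ω] [Module P Ω] [AddCommGroup Ω'] [Module P Ω'] [Module B Ω']
  [IsScalarTower P B Ω']

theorem exists_basis_eq_localizedModule_map (ℓ : Ω →ₗ[P] Ω') [IsLocalizedModule p.primeCompl ℓ]
    (b : Module.Basis (Fin d) B Ω') :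
    ∃ (ω : Fin d → Ω) (b' : Module.Basis (Fin d) B Ω'), ∀ i, b' i = ℓ (ω i) := by
  choose y hy using fun i => IsLocalizedModule.surj p.primeCompl ℓ (b i)
  refine ⟨fun i => (y i).1, b.isUnitSMul (w := fun i => algebraMap P B (y i).2)
    (fun i => IsLocalization.map_units B (y i).2), fun i => ?_⟩
  rw [Module.Basis.isUnitSMul_apply, algebraMap_smul]
  exact hy i

include p in
theorem exists_smul_eq_sum_smul (ℓ : Ω →ₗ[P] Ω') [IsLocalizedModule p.primeCompl ℓ]
    (b : Module.Basis (Fin d) B Ω') (ω : Fin d → Ω) (hb : ∀ i, b i = ℓ (ω i)) (η : Ω) :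
    ∃ s ∉ p, ∃ c : Fin d → P, s • η = ∑ i, c i • ω i := by
  obtain ⟨t, ht⟩ := IsLocalization.exist_integer_multiples_of_finite p.primeCompl
    (fun i => b.repr (ℓ η) i)
  choose c hc using ht
  have h : ℓ (t • η) = ℓ (∑ i, c i • ω i) := by
    rw [map_sum]
    simp only [map_smul, ← hb]
    rw [Submonoid.smul_def, map_smul, ← b.sum_repr (ℓ η), Finset.smul_sum]
    refine Finset.sum_congr rfl fun i _ => ?_
    rw [← smul_assoc, ← hc, algebraMap_smul]
  obtain ⟨u, hu⟩ := IsLocalizedModule.exists_of_eq (S := p.primeCompl) h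
  refine ⟨u * t, (u * t).2, fun i => u * c i, ?_⟩
  simpa only [Submonoid.smul_def, Finset.smul_sum, smul_smul] using hu

include p in
theorem map_ker_le_maximalIdeal [IsLocalRing R] :
    (RingHom.ker π).map (algebraMap A R) ≤ IsLocalRing.maximalIdeal R := by
  rw [Ideal.map_le_iff_le_comap]
  refine le_of_le_of_eq (fun a ha => ?_)
    (IsLocalization.AtPrime.under_maximalIdeal R (p.comap π)).symm
  rw [Ideal.mem_comap, (RingHom.mem_ker).mp ha]
  exact p.zero_mem

theorem map_ker_le_span_of_forall_mem [IsNoetherianRing R] (x : Fin d → A)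
    (h : ∀ a, π a = 0 → ∃ s ∉ p, algebraMap P A s * a ∈
      Ideal.span (Set.range x) ⊔ RingHom.ker π ^ 2) :
    (RingHom.ker π).map (algebraMap A R) ≤ Ideal.span (Set.range (algebraMap A R ∘ x)) := by
  have := IsLocalization.AtPrime.isLocalRing R (p.comap π)
  refine Submodule.le_of_le_smul_of_le_jacobson_bot (I := (RingHom.ker π).map (algebraMap A R))
    (IsNoetherian.noetherian _) ((map_ker_le_maximalIdeal π p).trans
      (IsLocalRing.jacobson_eq_maximalIdeal _ bot_ne_top).ge) ?_
  rw [Ideal.map_le_iff_le_comap]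
  intro a ha
  obtain ⟨s, hs, hsa⟩ := h a ha
  have hu : IsUnit (algebraMap A R (algebraMap P A s)) :=
    IsLocalization.map_units R
      (⟨algebraMap P A s, by simpa [Ideal.primeCompl] using hs⟩ : (p.comap π).primeCompl)
  rw [Ideal.mem_comap, ← Ideal.unit_mul_mem_iff_mem _ hu, ← map_mul]
  have := Ideal.mem_map_of_mem (algebraMap A R) hsa
  rwa [Ideal.map_sup, Ideal.map_span, ← Set.range_comp, Ideal.map_pow, sq, ← smul_eq_mul] at this

include p in
theorem exists_sub_algebraMap_mem_map_ker [Algebra P R] [IsScalarTower P A R] [Algebra B R]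
    [IsScalarTower P B R] (r : R) :
    ∃ b, r - algebraMap B R b ∈ (RingHom.ker π).map (algebraMap A R) := by
  obtain ⟨a, s, rfl⟩ := IsLocalization.exists_mk'_eq (p.comap π).primeCompl r
  let t : p.primeCompl := ⟨π s, s.2⟩
  refine ⟨IsLocalization.mk' B (π a) t, ?_⟩
  have hu := (IsLocalization.map_units R s).mul
    ((IsLocalization.map_units B t).map (algebraMap B R))
  rw [← Ideal.unit_mul_mem_iff_mem _ hu]
  have h1 : algebraMap A R s * IsLocalization.mk' R a s = algebraMap A R a :=
    IsLocalization.mk'_spec' R a s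
  have h2 : algebraMap B R (algebraMap P B t) * algebraMap B R (IsLocalization.mk' B (π a) t) =
      algebraMap B R (algebraMap P B (π a)) := by
    rw [← map_mul, IsLocalization.mk'_spec']
  have h3 : algebraMap A R s * algebraMap B R (algebraMap P B t) *
      (IsLocalization.mk' R a s - algebraMap B R (IsLocalization.mk' B (π a) t)) =
      algebraMap A R (algebraMap P A (π s) * a - s * algebraMap P A (π a)) := by
    calc _ = algebraMap B R (algebraMap P B t) * (algebraMap A R s * IsLocalization.mk' R a s) -
        algebraMap A R s * (algebraMap B R (algebraMap P B t) *
          algebraMap B R (IsLocalization.mk' B (π a) t)) := by ring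
      _ = _ := by
        rw [h1, h2, map_sub, map_mul, map_mul]
        simp only [← IsScalarTower.algebraMap_apply, t]
  rw [h3]
  refine Ideal.mem_map_of_mem _ ?_
  rw [RingHom.mem_ker, map_sub, map_mul, map_mul, AlgHom.commutes, AlgHom.commutes]
  simp

theorem exists_isRegular_ofList_eq_map_ker [IsNoetherianRing R] [Algebra.FormallySmooth P A]
    (D : A →ₗ[P] Ω) (hD : ∀ a b, D (a * b) = π a • D b + π b • D a)
    (hsurj : ∀ ω, ∃ a, π a = 0 ∧ D a = ω)
    (hker : ∀ a, π a = 0 → D a = 0 → a ∈ RingHom.ker π ^ 2)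
    (ℓ : Ω →ₗ[P] Ω') [IsLocalizedModule p.primeCompl ℓ] (b : Module.Basis (Fin d) B Ω') :
    ∃ rs : List R, RingTheory.Sequence.IsRegular R rs ∧ rs.length = d ∧
      Ideal.ofList rs = (RingHom.ker π).map (algebraMap A R) := by
  let : Algebra P R := ((algebraMap A R).comp (algebraMap P A)).toAlgebra
  have : IsScalarTower P A R := .of_algebraMap_eq fun _ => rfl
  have hunit (s : p.primeCompl) : IsUnit (algebraMap P R s) :=
    IsLocalization.map_units R
      (⟨algebraMap P A s, by simpa [Ideal.primeCompl] using s.2⟩ : (p.comap π).primeCompl)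
  let : Algebra B R := (IsLocalization.lift (M := p.primeCompl) hunit).toAlgebra
  have : IsScalarTower P B R := .of_algebraMap_eq fun c => (IsLocalization.lift_eq hunit c).symm
  have := IsLocalization.AtPrime.isLocalRing R (p.comap π)
  obtain ⟨ω, b, hb⟩ := exists_basis_eq_localizedModule_map p ℓ b
  choose x hx hDx using fun i => hsurj (ω i)
  have hspan : Ideal.span (Set.range (algebraMap A R ∘ x)) =
      (RingHom.ker π).map (algebraMap A R) := by
    refine le_antisymm ?_ (map_ker_le_span_of_forall_mem π p x fun a ha => ?_)
    · rw [Ideal.span_le]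
      rintro _ ⟨i, rfl⟩
      exact Ideal.mem_map_of_mem _ (hx i)
    · obtain ⟨s, hs, c, hc⟩ := exists_smul_eq_sum_smul p ℓ b ω hb (D a)
      refine ⟨s, hs, ?_⟩
      rw [← sub_add_cancel (algebraMap P A s * a) (∑ i, algebraMap P A (c i) * x i)]
      refine add_mem (Ideal.mem_sup_right (hker _ ?_ ?_)) (Ideal.mem_sup_left ?_)
      · simp [ha, hx]
      · simp only [← Algebra.smul_def, map_sub, map_smul, map_sum, hDx, hc, sub_self]
      · exact Ideal.sum_mem _ fun i _ =>
          Ideal.mul_mem_left _ _ (Ideal.subset_span (Set.mem_range_self i))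
  let D' : A →ₗ[P] Fin d → B := (b.equivFun.toLinearMap.restrictScalars P) ∘ₗ ℓ ∘ₗ D
  refine ⟨List.ofFn (algebraMap A R ∘ x), isRegular_ofFn_of_algHom (B := B) _ (fun i => ?_)
    (fun r => ?_) (fun n => ?_), List.length_ofFn, ?_⟩
  · exact map_ker_le_maximalIdeal π p (Ideal.mem_map_of_mem _ (hx i))
  · rw [hspan]
    exact exists_sub_algebraMap_mem_map_ker π p r
  · refine exists_algHom_of_formallySmooth π p D' (fun u v => ?_) x hx (fun i => ?_) n
    · simp only [D', LinearMap.comp_apply, hD, map_add, map_smul]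
    · simp only [D', LinearMap.comp_apply, hDx, ← hb]
      ext j
      simp [Pi.single_apply, eq_comm]
  · rw [← hspan, Ideal.ofList]
    simp only [List.mem_ofFn]
    rfl

end Generators

section Localization

theorem nonempty_linearEquiv_quotient_map {A R M L : Type*} [CommRing A] [CommRing R] [Algebra A R]
    (S : Submonoid A) [IsLocalization S R] [AddCommGroup M] [Module A M] [AddCommGroup L]
    [Module A L] [Module R L] [IsScalarTower A R L] (f : M →ₗ[A] L) [IsLocalizedModule S f]
    (I : Ideal A) (e : (A ⧸ I) ≃ₗ[A] M) : Nonempty (L ≃ₗ[R] R ⧸ I.map (algebraMap A R)) := by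
  let g := Submodule.toLocalizedQuotient' R S (Algebra.linearMap A R) I
  let h : L ≃ₗ[A] R ⧸ I.localized' R S (Algebra.linearMap A R) :=
    IsLocalizedModule.linearEquiv S (f ∘ₗ e.toLinearMap) g
  exact ⟨(h.extendScalarsOfIsLocalization S R).trans
    (Submodule.quotEquivOfEq _ _ (Ideal.localized'_eq_map R S I))⟩

theorem subsingleton_of_forall_smul_eq_zero {A M L : Type*} [CommRing A]
    (S : Submonoid A) [AddCommGroup M] [Module A M] [AddCommGroup L]
    [Module A L] (f : M →ₗ[A] L) [IsLocalizedModule S f] {a : A} (ha : a ∈ S)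
    (haM : ∀ m : M, a • m = 0) : Subsingleton L :=
  (IsLocalizedModule.subsingleton_iff S f).mpr fun m => ⟨a, ha, haM m⟩

theorem nonempty_linearEquiv_localization {A : Type u} [CommRing A] (S : Submonoid A)
    (N : ModuleCat.{u} A) (e : N ≃ₗ[A] A) :
    Nonempty (N.localizedModule S ≃ₗ[Localization S] Localization S) :=
  ⟨(IsLocalizedModule.linearEquiv S (N.localizedModuleMkLinearMap S)
    (Algebra.linearMap A (Localization S) ∘ₗ
      e.toLinearMap)).extendScalarsOfIsLocalization S (Localization S)⟩

end Localization

section Kaehler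

open Abelian

variable {K P : Type u} [CommRing K] [CommRing P] [Algebra K P]

theorem exists_isRegular_ofList_eq_map_kaehlerIdeal [Algebra.FormallySmooth K P]
    [IsNoetherianRing (P ⊗[K] P)] [Module.Finite P Ω[P⁄K]] [Module.Projective P Ω[P⁄K]] {d : ℕ}
    (m : Ideal (P ⊗[K] P)) [m.IsPrime] (hm : KaehlerDifferential.ideal K P ≤ m)
    (hd : ∀ (p : Ideal P) (_ : p.IsPrime),
      Module.rank (Localization.AtPrime p) (LocalizedModule p.primeCompl Ω[P⁄K]) = d) :
    ∃ rs : List (Localization.AtPrime m),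
      RingTheory.Sequence.IsRegular (Localization.AtPrime m) rs ∧ rs.length = d ∧
      Ideal.ofList rs =
        (KaehlerDifferential.ideal K P).map (algebraMap _ (Localization.AtPrime m)) := by
  let π : P ⊗[K] P →ₐ[P] P := Algebra.TensorProduct.lmul'' K
  let p : Ideal P := m.comap (algebraMap P (P ⊗[K] P))
  have hp : p.comap π = m := by
    ext a
    have ha : a - algebraMap P (P ⊗[K] P) (π a) ∈ m := hm <| by
      change π _ = 0
      rw [map_sub, AlgHom.commutes, Algebra.algebraMap_self_apply, sub_self]
    rw [Ideal.mem_comap, Ideal.mem_comap]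
    exact ⟨fun h => by simpa using add_mem ha h, fun h => by simpa using sub_mem h ha⟩
  have : IsLocalization.AtPrime (Localization.AtPrime m) (p.comap π) := by
    have h : (p.comap π).primeCompl = m.primeCompl := by
      ext a
      exact not_congr (by rw [hp])
    rw [IsLocalization.AtPrime, h]
    infer_instance
  have : Module.Free (Localization.AtPrime p) (LocalizedModule p.primeCompl Ω[P⁄K]) :=
    Module.free_of_flat_of_isLocalRing
  let b : Module.Basis (Fin d) (Localization.AtPrime p) (LocalizedModule p.primeCompl Ω[P⁄K]) :=
    Module.finBasisOfFinrankEq _ _ (Module.finrank_eq_of_rank_eq (hd p inferInstance))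
  refine exists_isRegular_ofList_eq_map_ker π p (KaehlerDifferential.D K P).tensorProductTo
    (Derivation.tensorProductTo_mul _) (fun ω => ?_) (fun a ha h => ?_)
    (LocalizedModule.mkLinearMap p.primeCompl Ω[P⁄K]) b
  · obtain ⟨a, rfl⟩ := KaehlerDifferential.fromIdeal_surjective K P ω
    exact ⟨a, a.2, KaehlerDifferential.D_tensorProductTo a⟩
  · exact (Ideal.toCotangent_eq_zero _ ⟨a, ha⟩).mp
      ((KaehlerDifferential.D_tensorProductTo ⟨a, ha⟩).symm.trans h)

theorem subsingleton_ext_tensorProduct_self [IsNoetherianRing P] [Algebra.EssFiniteType K P]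
    [Algebra.FormallySmooth K P] [Module.Finite P Ω[P⁄K]] [Module.Projective P Ω[P⁄K]] {d : ℕ}
    (hd : ∀ (p : Ideal P) (_ : p.IsPrime),
      Module.rank (Localization.AtPrime p) (LocalizedModule p.primeCompl Ω[P⁄K]) = d)
    (M : ModuleCat.{u} (P ⊗[K] P))
    (e : ((P ⊗[K] P) ⧸ KaehlerDifferential.ideal K P) ≃ₗ[P ⊗[K] P] M) (n : ℕ) (hn : n ≠ d) :
    Subsingleton (Ext.{u} M (ModuleCat.of (P ⊗[K] P) (P ⊗[K] P)) n) := by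
  have : IsNoetherianRing (P ⊗[K] P) := Algebra.EssFiniteType.isNoetherianRing P (P ⊗[K] P)
  have : Module.Finite (P ⊗[K] P) M := Module.Finite.equiv e
  refine subsingleton_ext_of_localized _ _ n fun m hmax => ?_
  by_cases hm : KaehlerDifferential.ideal K P ≤ m
  · obtain ⟨rs, hrs, rfl, hI⟩ := exists_isRegular_ofList_eq_map_kaehlerIdeal m hm hd
    obtain ⟨eM⟩ := nonempty_linearEquiv_quotient_map (R := Localization.AtPrime m) m.primeCompl
      (M.localizedModuleMkLinearMap m.primeCompl) (KaehlerDifferential.ideal K P) e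
    obtain ⟨eN⟩ := nonempty_linearEquiv_localization m.primeCompl
      (ModuleCat.of (P ⊗[K] P) (P ⊗[K] P)) (LinearEquiv.refl _ _)
    exact subsingleton_ext_of_isRegular rs hrs _ _
      (eM.trans (Submodule.quotEquivOfEq _ _ hI.symm))
      eN n hn
  · obtain ⟨a, ha, ham⟩ := SetLike.not_le_iff_exists.mp hm
    have : Subsingleton (M.localizedModule m.primeCompl) :=
      subsingleton_of_forall_smul_eq_zero m.primeCompl
        (M.localizedModuleMkLinearMap m.primeCompl) (a := a) ham fun x => by
          obtain ⟨y, rfl⟩ := e.surjective x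
          obtain ⟨y, rfl⟩ := Ideal.Quotient.mk_surjective y
          rw [← map_smul]
          have hy : a • Ideal.Quotient.mk (KaehlerDifferential.ideal K P) y = 0 :=
            Ideal.Quotient.eq_zero_iff_mem.mpr (Ideal.mul_mem_right y _ ha)
          rw [hy, map_zero]
    have hz := ModuleCat.isZero_of_subsingleton (M.localizedModule m.primeCompl)
    have := hz.hasProjectiveDimensionLT_zero
    exact HasProjectiveDimensionLT.subsingleton _ 0 n (Nat.zero_le n) _

end Kaehler

theorem stmt4 (K P : Type) [CommRing K] [CommRing P] [IsNoetherianRing K]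
    [IsNoetherianRing P] [Algebra K P] (d : ℕ)
    (hsm : EssentiallySmooth K P) (hd : RelDim K P d) :
    letI : Algebra (P ⊗[K] P) P :=
      (Algebra.TensorProduct.lmul' (S := P) K).toRingHom.toAlgebra
    ∀ n : ℕ, n ≠ d →
      Subsingleton (((Ext (P ⊗[K] P) (ModuleCat (P ⊗[K] P)) n).obj
        (Opposite.op (ModuleCat.of (P ⊗[K] P) P))).obj
          (ModuleCat.of (P ⊗[K] P) (P ⊗[K] P))) := by
  intro n hn
  let : Algebra (P ⊗[K] P) P :=
    (Algebra.TensorProduct.lmul' (S := P) K).toRingHom.toAlgebra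
  obtain ⟨_, _, _⟩ := hsm
  obtain ⟨_, _, hrank⟩ := hd
  refine subsingleton_ext_obj_of_subsingleton_abelianExt _ _ n
    (subsingleton_ext_tensorProduct_self hrank _ ?_ n hn)
  let f : P ⊗[K] P →ₗ[P ⊗[K] P] P := Algebra.linearMap _ _
  have hf : Function.Surjective f := fun x =>
    ⟨x ⊗ₜ 1, (Algebra.TensorProduct.lmul'_apply_tmul x 1).trans (mul_one x)⟩
  exact (Submodule.quotEquivOfEq _ _ rfl).trans (f.quotKerEquivOfSurjective hf)
end
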